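/- Assume (W) in dimension N = 1 with g ≡ 1/π, and let p0 ≠ 0 and L ∈ ℝ. There exists a constant C > 0 independent of x such that for all δ > 0 with 1/(δ|p0|) ≥ 2 and every x ∈ ℝ, the limit lim_{n→∞} NL_L^{λ̄_δ^L}[s_{δ,n}^L](x) exists and satisfies −Cδ² ≤ lim_{n→∞} NL_L^{λ̄_δ^L}[s_{δ,n}^L](x) ≤ Cδ². -/

import Mathlib

open MeasureTheory Set Filter Topology Metric

noncomputable section

/-- `I1^{1,r}[U,x]` in dimension one with `g ≡ 1/π` (half-Laplacian). -/
def J1 (r : ℝ) (U : ℝ → ℝ) (x : ℝ) : ℝ :=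
  ∫ z in {z : ℝ | |z| ≤ r}, (U (x + z) - U x - deriv U x * z) / (Real.pi * z ^ 2)

/-- `I1^{2,r}[U,x]` in dimension one with `g ≡ 1/π`. -/
def J2 (r : ℝ) (U : ℝ → ℝ) (x : ℝ) : ℝ :=
  ∫ z in {z : ℝ | r < |z|}, (U (x + z) - U x) / (Real.pi * z ^ 2)

/-- The one-dimensional operator `I1 = -(-Δ)^{1/2}`. -/
def halfLap (U : ℝ → ℝ) (x : ℝ) : ℝ := J1 1 U x + J2 1 U x

/-- Assumption (W): `W ∈ C^{4,β}`, 1-periodic, vanishing exactly on ℤ, with `W''(0) > 0`. -/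
def AssumptionW (W : ℝ → ℝ) : Prop :=
  (∃ β ∈ Ioo (0:ℝ) 1, ContDiff ℝ 4 W ∧
    ∃ Kβ : ℝ, ∀ a b : ℝ, |iteratedDeriv 4 W a - iteratedDeriv 4 W b| ≤ Kβ * |a - b| ^ β) ∧
  (∀ v : ℝ, W (v + 1) = W v) ∧
  (∀ k : ℤ, W (k : ℝ) = 0) ∧
  (∀ v : ℝ, (∀ k : ℤ, v ≠ (k : ℝ)) → 0 < W v) ∧
  0 < deriv (deriv W) 0

/-- The phase transition `φ`: solution of `I1[φ] = W'(φ)`, `φ(−∞)=0`, `φ(+∞)=1`,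
`φ(0)=1/2`, `φ' > 0` (it is of class `C^{4,β}`, with bounded derivatives). -/
def IsPhi (W φ : ℝ → ℝ) : Prop :=
  ContDiff ℝ 4 φ ∧
  (∀ x : ℝ, halfLap φ x = deriv W (φ x)) ∧
  Tendsto φ atBot (𝓝 0) ∧ Tendsto φ atTop (𝓝 1) ∧
  φ 0 = 1 / 2 ∧ (∀ x : ℝ, 0 < deriv φ x)

/-- The corrector `ψ`: solution of
`I1[ψ] = W''(φ)ψ + (L/α)(W''(φ) − W''(0)) + cφ'` with `ψ(±∞) = 0` and
`c = L/∫_ℝ(φ')²`. -/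
def IsPsi (W φ : ℝ → ℝ) (L : ℝ) (ψ : ℝ → ℝ) : Prop :=
  ContDiff ℝ 3 ψ ∧
  (∀ x : ℝ, halfLap ψ x =
    deriv (deriv W) (φ x) * ψ x +
    L / deriv (deriv W) 0 * (deriv (deriv W) (φ x) - deriv (deriv W) 0) +
    L / (∫ y : ℝ, (deriv φ y) ^ 2) * deriv φ x) ∧
  Tendsto ψ atBot (𝓝 0) ∧ Tendsto ψ atTop (𝓝 0)

/-- The approximation `s_{δ,n}^L` of the hull function ansatz. -/
def sApprox (W φ ψ : ℝ → ℝ) (L δ p0 : ℝ) (n : ℕ) (x : ℝ) : ℝ :=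
  L * δ / deriv (deriv W) 0 - n +
  (∑ i ∈ Finset.Icc (-(n:ℤ)) (n:ℤ), φ ((x - (i:ℝ)) / (δ * |p0|))) +
  δ * ∑ i ∈ Finset.Icc (-(n:ℤ)) (n:ℤ), ψ ((x - (i:ℝ)) / (δ * |p0|))

/-- `λ̄_δ^L = δ² c0 |p0| L` with `c0 = (∫_ℝ (φ')²)⁻¹`. -/
def lamBar (φ : ℝ → ℝ) (δ p0 L : ℝ) : ℝ :=
  δ ^ 2 * (∫ x : ℝ, (deriv φ x) ^ 2)⁻¹ * |p0| * L

/-- The operator `NL_L^λ[h] = λh' − δ|p0| I1[h] + W'(h) − δL` (for bounded `h`). -/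
def NLop (W : ℝ → ℝ) (L δ p0 lam : ℝ) (h : ℝ → ℝ) (x : ℝ) : ℝ :=
  lam * deriv h x - δ * |p0| * halfLap h x + deriv W (h x) - δ * L

/-- Principal-value tail `I1^{2,r}[h,x] = lim_{a→∞} ∫_{r<|y|<a} (h(x+y) − h(x)) dy/(πy²)`,
for functions of linear growth. -/
def J2pv (r : ℝ) (h : ℝ → ℝ) (x : ℝ) : ℝ :=
  limUnder atTop (fun a : ℝ =>
    ∫ z in {z : ℝ | r < |z| ∧ |z| < a}, (h (x + z) - h x) / (Real.pi * z ^ 2))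

/-- The operator `I1` with principal-value tail. -/
def halfLapPV (h : ℝ → ℝ) (x : ℝ) : ℝ := J1 1 h x + J2pv 1 h x

/-- The operator `NL_L^λ` with principal-value tail. -/
def NLpv (W : ℝ → ℝ) (L δ p0 lam : ℝ) (h : ℝ → ℝ) (x : ℝ) : ℝ :=
  lam * deriv h x - δ * |p0| * halfLapPV h x + deriv W (h x) - δ * L

/-- First-order Taylor bound under a Lipschitz condition on the derivative. -/
lemma abs_taylor_le {f f' : ℝ → ℝ} (hf : ∀ t, HasDerivAt f (f' t) t) {x y K : ℝ}
    (hK : ∀ t ∈ uIcc x y, |f' t - f' x| ≤ K * |t - x|) :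
    |f y - f x - f' x * (y - x)| ≤ K * (y - x) ^ 2 := by
  rcases eq_or_ne y x with rfl | hxy
  · simp
  have hpos : 0 < |y - x| := abs_pos.2 (sub_ne_zero.2 hxy)
  have hK0 : 0 ≤ K := by
    have := (abs_nonneg _).trans (hK y right_mem_uIcc)
    exact nonneg_of_mul_nonneg_left this hpos
  have := Convex.norm_image_sub_le_of_norm_hasDerivWithin_le (s := uIcc x y)
    (f := fun t => f t - f' x * t) (f' := fun t => f' t - f' x) (x := x) (y := y)
    (C := K * |y - x|) (fun t _ => by
      have := ((hf t).sub ((hasDerivAt_id t).const_mul (f' x))).hasDerivWithinAt (s := uIcc x y)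
      rw [mul_one] at this
      exact this)
    (fun t ht => by
      refine (hK t ht).trans ?_
      gcongr K * ?_
      exact abs_sub_left_of_mem_uIcc ht)
    (convex_uIcc x y) left_mem_uIcc right_mem_uIcc
  simp only [Real.norm_eq_abs] at this
  calc _ = |f y - f' x * y - (f x - f' x * x)| := by congr 1; ring
    _ ≤ _ := this
    _ = _ := by rw [mul_assoc, abs_mul_abs_self]; ring

/-- Bounded functions of class `C²`. -/
def BddC2 (U : ℝ → ℝ) : Prop := ContDiff ℝ 2 U ∧ ∃ M, ∀ x, |U x| ≤ M

/-- The symmetric second difference form of the half-Laplacian. -/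
def symLap (U : ℝ → ℝ) (x : ℝ) : ℝ :=
  (∫ z in Ioi (0:ℝ), (U (x + z) + U (x - z) - 2 * U x) / z ^ 2) / Real.pi

lemma integral_eq_integral_Ioi_add_neg {g : ℝ → ℝ} (hg : Integrable g) :
    ∫ z, g z = ∫ z in Ioi (0:ℝ), (g z + g (-z)) := by
  rw [integral_add hg.integrableOn hg.comp_neg.integrableOn]
  have h := integral_comp_neg_Iic 0 (fun z => g (-z))
  simp only [neg_neg, neg_zero] at h
  rw [← h, ← compl_Ioi, integral_add_compl measurableSet_Ioi hg]

namespace BddC2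

variable {U V : ℝ → ℝ}

lemma continuous (hU : BddC2 U) : Continuous U := hU.1.continuous

lemma add (hU : BddC2 U) (hV : BddC2 V) : BddC2 (fun x => U x + V x) := by
  obtain ⟨hU, M, hM⟩ := hU
  obtain ⟨hV, N, hN⟩ := hV
  exact ⟨hU.add hV, M + N, fun x => (abs_add_le _ _).trans (add_le_add (hM x) (hN x))⟩

lemma const_mul (hU : BddC2 U) (c : ℝ) : BddC2 (fun x => c * U x) := by
  obtain ⟨hU, M, hM⟩ := hU
  refine ⟨contDiff_const.mul hU, |c| * M, fun x => ?_⟩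
  rw [abs_mul]
  exact mul_le_mul_of_nonneg_left (hM x) (abs_nonneg c)

lemma sub (hU : BddC2 U) (hV : BddC2 V) : BddC2 (fun x => U x - V x) := by
  simpa [sub_eq_add_neg] using hU.add (hV.const_mul (-1))

lemma const (c : ℝ) : BddC2 (fun _ => c) := ⟨contDiff_const, |c|, fun _ => le_rfl⟩

lemma comp_affine (hU : BddC2 U) (a c : ℝ) : BddC2 (fun x => U (a * x + c)) := by
  obtain ⟨hU, M, hM⟩ := hU
  exact ⟨hU.comp ((contDiff_const.mul contDiff_id).add contDiff_const), M, fun x => hM _⟩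

lemma sum {ι : Type*} (s : Finset ι) {u : ι → ℝ → ℝ} (hu : ∀ i, BddC2 (u i)) :
    BddC2 (fun x => ∑ i ∈ s, u i x) := by
  classical
  induction s using Finset.induction_on with
  | empty => simpa using const 0
  | insert i s hi ih => simpa [Finset.sum_insert hi] using (hu i).add ih

lemma hasDerivAt (hU : BddC2 U) (x : ℝ) : HasDerivAt U (deriv U x) x :=
  (hU.1.differentiable (by norm_num) x).hasDerivAt

lemma taylor (hU : BddC2 U) (x : ℝ) :
    ∃ C, ∀ z, |z| ≤ 1 → |U (x + z) - U x - deriv U x * z| ≤ C * z ^ 2 := by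
  have h1 : ContDiff ℝ 1 (deriv U) := by
    have := hU.1
    rw [show (2 : WithTop ℕ∞) = 1 + 1 by norm_num, contDiff_succ_iff_deriv] at this
    exact this.2.2
  obtain ⟨C, hC⟩ := (isCompact_Icc (a := x - 1) (b := x + 1)).exists_bound_of_continuousOn
    (h1.continuous_deriv le_rfl).continuousOn
  refine ⟨C, fun z hz => ?_⟩
  rw [abs_le] at hz
  have := abs_taylor_le (fun t => hU.hasDerivAt t) (x := x) (y := x + z) (K := C) (fun t ht => by
    have hsub : uIcc x (x + z) ⊆ Icc (x - 1) (x + 1) := by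
      exact uIcc_subset_Icc ⟨by linarith, by linarith⟩ ⟨by linarith, by linarith⟩
    exact (convex_Icc (x - 1) (x + 1)).norm_image_sub_le_of_norm_deriv_le
      (fun s _ => h1.differentiable (by norm_num) s) hC (hsub left_mem_uIcc) (hsub ht))
  simpa using this

lemma near_far (hU : BddC2 U) (x : ℝ) :
    IntegrableOn (fun z => (U (x + z) - U x - deriv U x * z) / (Real.pi * z ^ 2))
      {z : ℝ | |z| ≤ 1} ∧
    IntegrableOn (fun z => (U (x + z) - U x) / (Real.pi * z ^ 2)) {z : ℝ | 1 < |z|} := by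
  have hm : Measurable U := hU.continuous.measurable
  constructor
  · obtain ⟨C, hC⟩ := hU.taylor x
    have hset : {z : ℝ | |z| ≤ 1} = Icc (-1) 1 := by ext z; simp [abs_le]
    have hC0 : 0 ≤ C := by simpa using (abs_nonneg _).trans (hC 1 (by simp))
    refine Measure.integrableOn_of_bounded (M := C / Real.pi) (by rw [hset]; simp)
      (Measurable.aestronglyMeasurable (by fun_prop)) ?_
    refine (ae_restrict_iff' (by rw [hset]; exact measurableSet_Icc)).2 (ae_of_all _ fun z hz => ?_)
    rcases eq_or_ne z 0 with rfl | hz0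
    · simp; positivity
    have hz2 : 0 < z ^ 2 := by positivity
    have hp := Real.pi_pos
    rw [Real.norm_eq_abs, abs_div, abs_of_pos (mul_pos hp hz2), div_le_div_iff₀ (by positivity) hp]
    nlinarith [hC z hz]
  · obtain ⟨M, hM⟩ := hU.2
    have hM0 : 0 ≤ M := (abs_nonneg _).trans (hM 0)
    refine Integrable.mono' (g := fun z => (4 * M / Real.pi) * (1 + z ^ 2)⁻¹)
      (integrable_inv_one_add_sq.const_mul _).integrableOn
      (Measurable.aestronglyMeasurable (by fun_prop)) ?_
    refine (ae_restrict_iff' (measurableSet_lt measurable_const measurable_id.abs)).2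
      (ae_of_all _ fun z hz => ?_)
    have hz1 : 1 < z ^ 2 := by
      have : 1 < |z| := hz
      nlinarith [sq_abs z]
    have hp := Real.pi_pos
    have hnum : |U (x + z) - U x| ≤ 2 * M := by
      have := abs_sub (U (x + z)) (U x)
      linarith [hM (x + z), hM x]
    rw [Real.norm_eq_abs, abs_div, abs_of_pos (a := Real.pi * z ^ 2) (by positivity),
      ← div_eq_mul_inv, div_div, div_le_div_iff₀ (by positivity) (by positivity)]
    calc _ ≤ (2 * M) * (Real.pi * (1 + z ^ 2)) := by gcongr
      _ ≤ (2 * M) * (Real.pi * (z ^ 2 + z ^ 2)) := by gcongr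
      _ = _ := by ring

private lemma halfLap_symm_aux (hU : BddC2 U) (x : ℝ) :
    IntegrableOn (fun z => (U (x + z) + U (x - z) - 2 * U x) / z ^ 2) (Ioi 0) ∧
      halfLap U x = symLap U x := by
  obtain ⟨h1, h2⟩ := hU.near_far x
  have m1 : MeasurableSet {z : ℝ | |z| ≤ 1} := measurableSet_le measurable_id.abs measurable_const
  have m2 : MeasurableSet {z : ℝ | 1 < |z|} := measurableSet_lt measurable_const measurable_id.abs
  set g1 := indicator {z : ℝ | |z| ≤ 1}
    (fun z => (U (x + z) - U x - deriv U x * z) / (Real.pi * z ^ 2)) with hg1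
  set g2 := indicator {z : ℝ | 1 < |z|}
    (fun z => (U (x + z) - U x) / (Real.pi * z ^ 2)) with hg2
  have i1 : Integrable g1 := (integrable_indicator_iff m1).2 h1
  have i2 : Integrable g2 := (integrable_indicator_iff m2).2 h2
  have i := i1.add i2
  have key : ∀ z ∈ Ioi (0:ℝ), (g1 + g2) z + (g1 + g2) (-z) =
      (U (x + z) + U (x - z) - 2 * U x) / z ^ 2 / Real.pi := by
    intro z hz
    have hz' : z ≠ 0 := (mem_Ioi.1 hz).ne'
    have hp := Real.pi_ne_zero
    by_cases h : |z| ≤ 1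
    · have h' : ¬ 1 < |z| := not_lt.2 h
      simp only [hg1, hg2, Pi.add_apply, indicator, mem_ofPred_eq, abs_neg, h, h', if_true, if_false]
      rw [← sub_eq_add_neg]
      field_simp
      ring
    · have h' : 1 < |z| := not_le.1 h
      simp only [hg1, hg2, Pi.add_apply, indicator, mem_ofPred_eq, abs_neg, h, h', if_true, if_false]
      rw [← sub_eq_add_neg]
      field_simp
      ring
  constructor
  · have := ((i.add i.comp_neg).integrableOn (s := Ioi (0:ℝ))).congr_fun (f := _) (g := _) key
      measurableSet_Ioi
    have := Integrable.mul_const this Real.pi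
    refine IntegrableOn.congr_fun this (fun z _ => ?_) measurableSet_Ioi
    exact div_mul_cancel₀ _ Real.pi_ne_zero
  · rw [halfLap, J1, J2, ← integral_indicator m1, ← integral_indicator m2, ← integral_add i1 i2]
    have := integral_eq_integral_Ioi_add_neg i
    simp only [Pi.add_apply] at this key
    rw [this, setIntegral_congr_fun measurableSet_Ioi key, integral_div, symLap]

lemma integrableOn (hU : BddC2 U) (x : ℝ) :
    IntegrableOn (fun z => (U (x + z) + U (x - z) - 2 * U x) / z ^ 2) (Ioi 0) :=
  (hU.halfLap_symm_aux x).1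

lemma halfLap_eq (hU : BddC2 U) (x : ℝ) : halfLap U x = symLap U x :=
  (hU.halfLap_symm_aux x).2

lemma symLap_add (hU : BddC2 U) (hV : BddC2 V) (x : ℝ) :
    symLap (fun x => U x + V x) x = symLap U x + symLap V x := by
  rw [symLap, symLap, symLap, ← add_div, ← integral_add (hU.integrableOn x) (hV.integrableOn x)]
  congr 2
  ext z
  ring

end BddC2

lemma symLap_const_mul (U : ℝ → ℝ) (c x : ℝ) :
    symLap (fun x => c * U x) x = c * symLap U x := by
  rw [symLap, symLap, ← mul_div_assoc, ← integral_const_mul]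
  congr 2
  ext z
  ring

lemma symLap_const (c x : ℝ) : symLap (fun _ => c) x = 0 := by
  have : ∀ z : ℝ, (c + c - 2 * c) / z ^ 2 = 0 := fun z => by ring
  simp [symLap, this]

lemma symLap_comp_affine (U : ℝ → ℝ) {a : ℝ} (ha : 0 < a) (c x : ℝ) :
    symLap (fun x => U (a * x + c)) x = a * symLap U (a * x + c) := by
  have h := integral_comp_mul_left_Ioi
    (fun z => (U (a * x + c + z) + U (a * x + c - z) - 2 * U (a * x + c)) / z ^ 2) 0 ha
  rw [mul_zero, smul_eq_mul] at h
  rw [symLap, symLap, ← mul_div_assoc]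
  congr 1
  have ha' := ha.ne'
  calc _ = a ^ 2 * ∫ z in Ioi (0:ℝ), (U (a * x + c + a * z) + U (a * x + c - a * z)
        - 2 * U (a * x + c)) / (a * z) ^ 2 := by
        rw [← integral_const_mul]
        congr 1
        ext z
        rw [show a * (x + z) + c = a * x + c + a * z by ring,
          show a * (x - z) + c = a * x + c - a * z by ring]
        field_simp
    _ = _ := by
        rw [h]
        field_simp

lemma symLap_comp_add (U : ℝ → ℝ) (c x : ℝ) :
    symLap (fun x => U (x + c)) x = symLap U (x + c) := by
  simpa using symLap_comp_affine U one_pos c x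

namespace BddC2

variable {U V : ℝ → ℝ}

lemma symLap_sub (hU : BddC2 U) (hV : BddC2 V) (x : ℝ) :
    symLap (fun x => U x - V x) x = symLap U x - symLap V x := by
  have := hU.symLap_add (hV.const_mul (-1)) x
  rw [symLap_const_mul] at this
  simpa [sub_eq_add_neg] using this

lemma symLap_sum {ι : Type*} (s : Finset ι) {u : ι → ℝ → ℝ} (hu : ∀ i, BddC2 (u i)) (x : ℝ) :
    symLap (fun x => ∑ i ∈ s, u i x) x = ∑ i ∈ s, symLap (u i) x := by
  classical
  induction s using Finset.induction_on with
  | empty => simpa using symLap_const 0 x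
  | insert i s hi ih =>
    simp only [Finset.sum_insert hi]
    rw [(hu i).symLap_add (sum s hu), ih]

end BddC2

/-- At a global minimum the half-Laplacian is nonnegative. -/
lemma symLap_nonneg_of_min {U : ℝ → ℝ} {x : ℝ} (h : ∀ y, U x ≤ U y) : 0 ≤ symLap U x := by
  refine div_nonneg (setIntegral_nonneg measurableSet_Ioi fun z _ => ?_) Real.pi_pos.le
  exact div_nonneg (by linarith [h (x + z), h (x - z)]) (sq_nonneg z)

/-- The Lorentzian profile `1/(1+x²)`. -/
def lorentz (x : ℝ) : ℝ := (1 + x ^ 2)⁻¹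

/-- The odd conjugate `x/(1+x²)` of the Lorentzian profile. -/
def lorentzOdd (x : ℝ) : ℝ := x * lorentz x

lemma lorentz_pos (x : ℝ) : 0 < lorentz x := by unfold lorentz; positivity

lemma lorentz_le_one (x : ℝ) : lorentz x ≤ 1 := inv_le_one_of_one_le₀ (by nlinarith [sq_nonneg x])

lemma lorentz_mul (x : ℝ) : lorentz x * (1 + x ^ 2) = 1 :=
  inv_mul_cancel₀ (by positivity)

lemma abs_lorentzOdd_le (x : ℝ) : |lorentzOdd x| ≤ 1 := by
  have h1 := lorentz_mul x
  have h2 := lorentz_pos x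
  rw [lorentzOdd, abs_le]
  constructor <;> nlinarith [sq_nonneg (x - 1), sq_nonneg (x + 1)]

lemma lorentzOdd_sq_le (x : ℝ) : lorentzOdd x ^ 2 ≤ lorentz x := by
  have h1 := lorentz_mul x
  have h2 := lorentz_pos x
  rw [lorentzOdd]
  nlinarith

lemma contDiff_lorentz {n : WithTop ℕ∞} : ContDiff ℝ n lorentz :=
  (contDiff_const.add (contDiff_id.pow 2)).inv fun x => by positivity

lemma bddC2_lorentz : BddC2 lorentz :=
  ⟨contDiff_lorentz, 1, fun x => by
    rw [abs_of_pos (lorentz_pos x)]; exact lorentz_le_one x⟩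

lemma bddC2_lorentzOdd : BddC2 lorentzOdd :=
  ⟨contDiff_id.mul contDiff_lorentz, 1, abs_lorentzOdd_le⟩

lemma tendsto_log_ratio (x : ℝ) :
    Tendsto (fun z : ℝ => Real.log (1 + (x + z) ^ 2) - Real.log (1 + (x - z) ^ 2)) atTop (𝓝 0) := by
  have h0 : Tendsto (fun z : ℝ => z⁻¹) atTop (𝓝 0) := tendsto_inv_atTop_zero
  have hp : ∀ c : ℝ, Tendsto (fun z : ℝ => (z⁻¹) ^ 2 + (c * z⁻¹ + 1) ^ 2) atTop (𝓝 1) := by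
    intro c
    have := (h0.pow 2).add (((h0.const_mul c).add_const 1).pow 2)
    simpa using this
  have := ((hp x).div (hp (-x)) one_ne_zero).log (by norm_num)
  rw [div_one, Real.log_one] at this
  refine this.congr' ?_
  filter_upwards [eventually_gt_atTop 0] with z hz
  rw [← Real.log_div (by positivity) (by positivity)]
  congr 1
  simp only [Pi.div_apply]
  rw [div_eq_div_iff (by positivity) (by positivity)]
  field_simp
  ring

/-- Evaluation of the half-Laplacian through an explicit antiderivative. -/
lemma symLap_eq_of_kernel {U : ℝ → ℝ} (hU : BddC2 U) {x A B : ℝ}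
    (h : ∀ z, 0 < z → (U (x + z) + U (x - z) - 2 * U x) / z ^ 2 =
      A * (lorentz (x + z) + lorentz (x - z)) +
        B * ((x + z) * lorentz (x + z) + (x - z) * lorentz (x - z))) :
    symLap U x = A := by
  set G : ℝ → ℝ := fun z => A * (Real.arctan (x + z) - Real.arctan (x - z)) +
    B / 2 * (Real.log (1 + (x + z) ^ 2) - Real.log (1 + (x - z) ^ 2)) with hG
  have hadd : ∀ z : ℝ, HasDerivAt (fun z => x + z) 1 z := fun z => (hasDerivAt_id z).const_add x
  have hsub : ∀ z : ℝ, HasDerivAt (fun z => x - z) (-1) z := fun z => (hasDerivAt_id z).const_sub x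
  have hd : ∀ z, HasDerivAt G (A * (lorentz (x + z) + lorentz (x - z)) +
        B * ((x + z) * lorentz (x + z) + (x - z) * lorentz (x - z))) z := by
    intro z
    have p1 : (1:ℝ) + (x + z) ^ 2 ≠ 0 := by positivity
    have p2 : (1:ℝ) + (x - z) ^ 2 ≠ 0 := by positivity
    have h1 := (((hadd z).arctan.sub (hsub z).arctan).const_mul A).add
      ((((((hadd z).pow 2).const_add 1).log p1).sub
        ((((hsub z).pow 2).const_add 1).log p2)).const_mul (B / 2))
    refine h1.congr_deriv ?_
    simp only [lorentz]
    simp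
    field_simp
    ring
  have hat : Tendsto (fun z => Real.arctan (x + z) - Real.arctan (x - z)) atTop (𝓝 Real.pi) := by
    have h1 : Tendsto (fun z => Real.arctan (x + z)) atTop (𝓝 (Real.pi / 2)) :=
      (tendsto_nhds_of_tendsto_nhdsWithin Real.tendsto_arctan_atTop).comp
        (tendsto_atTop_add_const_left _ x tendsto_id)
    have h2 : Tendsto (fun z => Real.arctan (x - z)) atTop (𝓝 (-(Real.pi / 2))) :=
      (tendsto_nhds_of_tendsto_nhdsWithin Real.tendsto_arctan_atBot).comp
        (tendsto_atBot_add_const_left _ x tendsto_neg_atTop_atBot)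
    have := h1.sub h2
    rwa [sub_neg_eq_add, add_halves] at this
  have hlim : Tendsto G atTop (𝓝 (A * Real.pi)) := by
    simpa using (hat.const_mul A).add ((tendsto_log_ratio x).const_mul (B / 2))
  have hint := (hU.integrableOn x).congr_fun (fun z hz => h z hz) measurableSet_Ioi
  have := integral_Ioi_of_hasDerivAt_of_tendsto (hd 0).continuousAt.continuousWithinAt
    (fun z _ => hd z) hint hlim
  rw [symLap, setIntegral_congr_fun measurableSet_Ioi (fun z hz => h z hz), this]
  have hp := Real.pi_ne_zero
  simp [hG, hp]

lemma symLap_lorentz (x : ℝ) : symLap lorentz x = (x ^ 2 - 1) * lorentz x ^ 2 := by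
  refine symLap_eq_of_kernel bddC2_lorentz (B := 2 * x * lorentz x ^ 2) fun z hz => ?_
  simp only [lorentz]
  have e1 : 1 + (x + z) ^ 2 ≠ 0 := by positivity
  have e2 : 1 + (x - z) ^ 2 ≠ 0 := by positivity
  field_simp
  ring

lemma symLap_lorentzOdd (x : ℝ) : symLap lorentzOdd x = -2 * x * lorentz x ^ 2 := by
  refine symLap_eq_of_kernel bddC2_lorentzOdd (B := -(1 - x ^ 2) * lorentz x ^ 2) fun z hz => ?_
  simp only [lorentzOdd, lorentz]
  have e1 : 1 + (x + z) ^ 2 ≠ 0 := by positivity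
  have e2 : 1 + (x - z) ^ 2 ≠ 0 := by positivity
  field_simp
  ring

lemma symLap_lorentz_le (x : ℝ) : symLap lorentz x ≤ lorentz x := by
  rw [symLap_lorentz]
  have h1 := lorentz_mul x
  have h2 := lorentz_pos x
  nlinarith

lemma abs_symLap_lorentzOdd_le (x : ℝ) : |symLap lorentzOdd x| ≤ lorentz x := by
  rw [symLap_lorentzOdd]
  have h1 := lorentz_mul x
  have h2 := lorentz_pos x
  rw [abs_le]
  constructor <;>
  nlinarith [mul_nonneg (sq_nonneg (lorentz x)) (sq_nonneg (x - 1)),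
    mul_nonneg (sq_nonneg (lorentz x)) (sq_nonneg (x + 1))]

lemma tendsto_lorentz_cocompact : Tendsto lorentz (cocompact ℝ) (𝓝 0) := by
  rw [cocompact_eq_atBot_atTop]
  refine tendsto_inv_atTop_zero.comp (tendsto_atTop_add_const_left _ 1 ?_)
  refine Tendsto.sup ?_ (tendsto_pow_atTop two_ne_zero)
  refine ((tendsto_pow_atTop (α := ℝ) two_ne_zero).comp tendsto_neg_atBot_atTop).congr fun x => ?_
  simp

/-- Comparison principle: one-sided quadratic decay of a subsolution outside a compact set. -/
lemma exists_decay_le {m R : ℝ} (hm : 0 < m) :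
    ∃ C > 0, ∀ (w : ℝ → ℝ) (M : ℝ), 0 < M → BddC2 w → Tendsto w (cocompact ℝ) (𝓝 0) →
      (∀ x, |x| ≤ R → w x ≤ M) →
      (∀ x, R < |x| → 0 < w x → m * w x - M * lorentz x ≤ symLap w x) →
      ∀ x, w x ≤ C * M * lorentz x := by
  set y : ℝ := 1 + 2 / m with hy
  have hy1 : 1 < y := by rw [hy]; linarith [div_pos two_pos hm]
  have hy0 : 0 < y := by linarith
  set β : ℝ → ℝ := fun x => lorentz (y⁻¹ * x + 0) with hβ
  have hβb : BddC2 β := bddC2_lorentz.comp_affine _ _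
  have hβle : ∀ x, symLap β x ≤ m / 2 * β x := by
    intro x
    rw [hβ, symLap_comp_affine _ (inv_pos.2 hy0)]
    have h1 : y⁻¹ ≤ m / 2 := by
      rw [inv_le_comm₀ hy0 (by positivity), inv_div]; linarith
    have h2 := symLap_lorentz_le (y⁻¹ * x + 0)
    have h3 := lorentz_pos (y⁻¹ * x + 0)
    have h4 := inv_pos.2 hy0
    calc _ ≤ y⁻¹ * lorentz (y⁻¹ * x + 0) := by gcongr
      _ ≤ _ := by gcongr
  have hβlow : ∀ x, lorentz x ≤ β x := by
    intro x
    simp only [hβ, lorentz, add_zero]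
    have : y⁻¹ ≤ 1 := inv_le_one_of_one_le₀ hy1.le
    have h4 := inv_pos.2 hy0
    refine inv_anti₀ (by positivity) ?_
    rw [mul_pow]
    nlinarith [mul_nonneg (sq_nonneg x) (sub_nonneg.2 (pow_le_one₀ h4.le this (n := 2)))]
  have hβup : ∀ x, β x ≤ y ^ 2 * lorentz x := by
    intro x
    simp only [hβ, lorentz, add_zero]
    rw [← div_eq_mul_inv, inv_le_comm₀ (by positivity) (by positivity), inv_div,
      div_le_iff₀ (by positivity), mul_pow, inv_pow, add_mul, mul_right_comm,
      inv_mul_cancel₀ (by positivity)]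
    nlinarith
  set K : ℝ := 4 / m + (1 + R ^ 2) with hK
  have hK0 : 0 < K := by positivity
  refine ⟨K * y ^ 2, by positivity, fun w M hM hw hw0 hin hout x => ?_⟩
  suffices h : w x ≤ K * M * β x by
    calc w x ≤ K * M * β x := h
      _ ≤ K * M * (y ^ 2 * lorentz x) := by gcongr; exact hβup x
      _ = _ := by ring
  by_contra! hcon
  set v : ℝ → ℝ := fun x => K * M * β x - w x with hv
  have hvx : v x < 0 := by simp only [hv]; linarith
  have hvt : Tendsto v (cocompact ℝ) (𝓝 0) := by
    have h1 : Tendsto β (cocompact ℝ) (𝓝 0) := by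
      refine squeeze_zero (fun x => (lorentz_pos _).le) hβup ?_
      simpa using tendsto_lorentz_cocompact.const_mul (y ^ 2)
    simpa using (h1.const_mul (K * M)).sub hw0
  have hvb : BddC2 v := (hβb.const_mul (K * M)).sub hw
  obtain ⟨x1, hx1⟩ := hvb.continuous.exists_forall_le' x (hvt.eventually (Ici_mem_nhds hvx))
  have hneg : v x1 < 0 := (hx1 x).trans_lt hvx
  have hlap := symLap_nonneg_of_min hx1
  rw [hv, (hβb.const_mul (K * M)).symLap_sub hw, symLap_const_mul] at hlap
  have hb1 := hβlow x1
  have hl1 := lorentz_pos x1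
  have hwK : K * M * β x1 < w x1 := by simp only [hv] at hneg; linarith
  have hβ1 : 0 < β x1 := hl1.trans_le hb1
  have hw1 : 0 < w x1 := lt_trans (by positivity) hwK
  rcases le_or_gt |x1| R with h | h
  · have h2 := hin x1 h
    have h3 : 1 ≤ (1 + R ^ 2) * lorentz x1 := by
      have : x1 ^ 2 ≤ R ^ 2 := sq_le_sq' (by linarith [(abs_le.1 h).1]) (abs_le.1 h).2
      calc 1 = (1 + x1 ^ 2) * lorentz x1 := by rw [mul_comm, lorentz_mul]
        _ ≤ _ := by gcongr
    have h4 : M ≤ K * M * β x1 := by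
      calc M ≤ M * ((1 + R ^ 2) * lorentz x1) := le_mul_of_one_le_right hM.le h3
        _ ≤ M * (K * β x1) := by
          gcongr
          rw [hK]; linarith [show 0 < 4 / m by positivity]
        _ = _ := by ring
    linarith
  · have h2 := hout x1 h hw1
    have h3 := hβle x1
    have h4 : K * M * symLap β x1 ≤ K * M * (m / 2 * β x1) := by gcongr
    have h5 : m * (K * M * β x1) < m * w x1 := by gcongr
    have h6 : M * lorentz x1 ≤ M * β x1 := by gcongr
    have h7 : 4 ≤ m * K := by
      rw [hK, mul_add, mul_div_cancel₀ _ hm.ne']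
      nlinarith [mul_pos hm (show 0 < 1 + R ^ 2 by positivity)]
    have h8 : 4 * (M * β x1) ≤ m * K * (M * β x1) := by gcongr
    nlinarith [mul_pos hM hβ1]

/-- Quadratic decay for solutions of `I1[w] = a w + O(1/(1+x²))` with `a` bounded below near
infinity; the constant is uniform in `w`. -/
lemma exists_abs_decay_le {m R : ℝ} (hm : 0 < m) :
    ∃ C > 0, ∀ (w : ℝ → ℝ) (M : ℝ), 0 < M → BddC2 w → Tendsto w (cocompact ℝ) (𝓝 0) →
      (∀ x, |x| ≤ R → |w x| ≤ M) →
      (∀ x, R < |x| → ∃ a, m ≤ a ∧ |symLap w x - a * w x| ≤ M * lorentz x) →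
      ∀ x, |w x| ≤ C * M * lorentz x := by
  obtain ⟨C, hC, h⟩ := exists_decay_le (R := R) hm
  refine ⟨C, hC, fun w M hM hw hw0 hin hout x => abs_le'.2 ⟨?_, ?_⟩⟩
  · refine h w M hM hw hw0 (fun x hx => (abs_le.1 (hin x hx)).2) (fun x hx hwx => ?_) x
    obtain ⟨a, ha, hb⟩ := hout x hx
    nlinarith [(abs_le.1 hb).1, mul_le_mul_of_nonneg_right ha hwx.le]
  · have hneg : (fun x => -1 * w x) = fun x => -w x := by ext; ring
    have := h (fun x => -1 * w x) M hM (hw.const_mul (-1)) (by simpa using hw0.neg)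
      (fun x hx => by linarith [(abs_le.1 (hin x hx)).1]) (fun x hx hwx => ?_) x
    · linarith
    · obtain ⟨a, ha, hb⟩ := hout x hx
      rw [symLap_const_mul]
      nlinarith [(abs_le.1 hb).2, mul_le_mul_of_nonneg_right ha hwx.le]

lemma contDiff_deriv {f : ℝ → ℝ} {n : ℕ} (h : ContDiff ℝ (n + 1 : ℕ) f) :
    ContDiff ℝ n (deriv f) := by
  push_cast at h
  exact (contDiff_succ_iff_deriv.1 h).2.2

lemma periodic_deriv {f : ℝ → ℝ} (h : Function.Periodic f 1) : Function.Periodic (deriv f) 1 := by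
  intro x
  rw [← deriv_comp_add_const]
  congr 1
  ext y
  exact h y

/-- `F` is a `1`-periodic force vanishing on `ℤ`, with derivatives `G = F'`, `H = G'`
controlled by `M`. -/
structure IsForce (F G H : ℝ → ℝ) (M : ℝ) : Prop where
  pos : 0 < M
  derivF : ∀ x, HasDerivAt F (G x) x
  derivG : ∀ x, HasDerivAt G (H x) x
  boundG : ∀ x, |G x| ≤ M
  boundH : ∀ x, |H x| ≤ M
  lipH : ∀ x y, |H x - H y| ≤ M * |x - y|
  perF : Function.Periodic F 1
  perG : Function.Periodic G 1
  zero : F 0 = 0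

lemma abs_sub_le_of_deriv_le {f f' : ℝ → ℝ} (hf : ∀ x, HasDerivAt f (f' x) x) {M : ℝ}
    (hM : ∀ x, |f' x| ≤ M) (x y : ℝ) : |f x - f y| ≤ M * |x - y| :=
  convex_univ.norm_image_sub_le_of_norm_hasDerivWithin_le
    (fun z _ => (hf z).hasDerivWithinAt) (fun z _ => hM z) (mem_univ y) (mem_univ x)

/-- The force `W'` attached to a potential satisfying (W). -/
lemma AssumptionW.exists_isForce {W : ℝ → ℝ} (hW : AssumptionW W) :
    ∃ M, IsForce (deriv W) (deriv (deriv W)) (deriv (deriv (deriv W))) M := by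
  obtain ⟨⟨_, _, h4, _⟩, hper, hzero, hpos, _⟩ := hW
  have c4 : ContDiff ℝ (3 + 1 : ℕ) W := by exact_mod_cast h4
  have c3 : ContDiff ℝ (2 + 1 : ℕ) (deriv W) := contDiff_deriv c4
  have c2 : ContDiff ℝ (1 + 1 : ℕ) (deriv (deriv W)) := contDiff_deriv c3
  have c1 : ContDiff ℝ (0 + 1 : ℕ) (deriv (deriv (deriv W))) := contDiff_deriv c2
  have c0 : ContDiff ℝ (0 : ℕ) (deriv (deriv (deriv (deriv W)))) := contDiff_deriv c1
  have p1 := periodic_deriv hper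
  have p2 := periodic_deriv p1
  have p3 := periodic_deriv p2
  have p4 := periodic_deriv p3
  have d : ∀ {f : ℝ → ℝ} {n : ℕ}, ContDiff ℝ (n + 1 : ℕ) f → ∀ x, HasDerivAt f (deriv f x) x :=
    fun h x => (h.differentiable (by simp) x).hasDerivAt
  have bdd : ∀ {f : ℝ → ℝ}, Function.Periodic f 1 → Continuous f → ∃ M, ∀ x, |f x| ≤ M := by
    intro f hp hc
    obtain ⟨M, hM⟩ := (hp.isBounded_of_continuous one_ne_zero hc).exists_norm_le
    exact ⟨M, fun x => hM _ (mem_range_self x)⟩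
  obtain ⟨M2, h2⟩ := bdd p2 c2.continuous
  obtain ⟨M3, h3⟩ := bdd p3 c1.continuous
  obtain ⟨M4, h4⟩ := bdd p4 c0.continuous
  have n2 := (abs_nonneg _).trans (h2 0)
  have n3 := (abs_nonneg _).trans (h3 0)
  have n4 := (abs_nonneg _).trans (h4 0)
  have hmin : ∀ x, 0 ≤ W x := fun x => by
    by_cases hx : ∀ k : ℤ, x ≠ k
    · exact (hpos x hx).le
    · push Not at hx
      obtain ⟨k, rfl⟩ := hx
      exact (hzero k).ge
  refine ⟨M2 + M3 + M4 + 1, by positivity, d c3, d c2, fun x => (h2 x).trans (by linarith),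
    fun x => (h3 x).trans (by linarith), fun x y => ?_, p1, p2, ?_⟩
  · refine (abs_sub_le_of_deriv_le (d c1) h4 x y).trans ?_
    gcongr
    linarith
  · have h0 : W 0 = 0 := by exact_mod_cast hzero 0
    exact IsLocalMin.deriv_eq_zero (Eventually.of_forall fun x => by rw [h0]; exact hmin x)

namespace IsForce

variable {F G H : ℝ → ℝ} {M : ℝ}

lemma lipG (h : IsForce F G H M) (x y : ℝ) : |G x - G y| ≤ M * |x - y| :=
  abs_sub_le_of_deriv_le h.derivG h.boundH x y

lemma taylorF (h : IsForce F G H M) (x t : ℝ) : |F (x + t) - F x - G x * t| ≤ M * t ^ 2 := by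
  simpa using abs_taylor_le (x := x) (y := x + t) h.derivF fun s _ => h.lipG s x

lemma taylorG (h : IsForce F G H M) (x t : ℝ) : |G (x + t) - G x - H x * t| ≤ M * t ^ 2 := by
  simpa using abs_taylor_le (x := x) (y := x + t) h.derivG fun s _ => h.lipH s x

lemma abs_F_sub_le (h : IsForce F G H M) (t : ℝ) : |F t - G 0 * t| ≤ M * t ^ 2 := by
  simpa [h.zero] using h.taylorF 0 t

lemma abs_G_sub_le (h : IsForce F G H M) (t : ℝ) : |G t - G 0 - H 0 * t| ≤ M * t ^ 2 := by
  simpa using h.taylorG 0 t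

lemma F_add_int (h : IsForce F G H M) (x : ℝ) (k : ℤ) : F (x + k) = F x := by
  simpa using (h.perF.int_mul k) x

lemma G_add_int (h : IsForce F G H M) (x : ℝ) (k : ℤ) : G (x + k) = G x := by
  simpa using (h.perG.int_mul k) x

lemma exists_mvt (h : IsForce F G H M) (x y : ℝ) :
    ∃ ξ ∈ uIcc x y, F y - F x = G ξ * (y - x) := by
  rcases lt_trichotomy x y with hxy | rfl | hxy
  · obtain ⟨ξ, hξ, he⟩ := exists_hasDerivAt_eq_slope F G hxy
      (fun z _ => (h.derivF z).continuousAt.continuousWithinAt) (fun z _ => h.derivF z)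
    refine ⟨ξ, by rw [uIcc_of_le hxy.le]; exact Ioo_subset_Icc_self hξ, ?_⟩
    rw [he, div_mul_cancel₀ _ (by linarith)]
  · exact ⟨x, left_mem_uIcc, by simp⟩
  · obtain ⟨ξ, hξ, he⟩ := exists_hasDerivAt_eq_slope F G hxy
      (fun z _ => (h.derivF z).continuousAt.continuousWithinAt) (fun z _ => h.derivF z)
    refine ⟨ξ, by rw [uIcc_of_ge hxy.le]; exact Ioo_subset_Icc_self hξ, ?_⟩
    rw [he, div_mul_eq_mul_div, eq_div_iff (sub_pos.2 hxy).ne']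
    ring

end IsForce

/-- The Heaviside step. -/
def step (x : ℝ) : ℤ := if 0 < x then 1 else 0

lemma step_of_pos {x : ℝ} (h : 0 < x) : step x = 1 := if_pos h

lemma step_of_nonpos {x : ℝ} (h : x ≤ 0) : step x = 0 := if_neg (not_lt.2 h)

lemma step_eq_of_close {x y R : ℝ} (hR : 2 ≤ R) (hx : R < |x|) (hy : |y - x| ≤ 2) :
    step y = step x := by
  rw [abs_le] at hy
  rcases lt_abs.1 hx with h | h
  · rw [step_of_pos (by linarith), step_of_pos (by linarith)]
  · rw [step_of_nonpos (by linarith), step_of_nonpos (by linarith)]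

lemma exists_radius_of_eventually {P : ℝ → Prop} (h : ∀ᶠ x in cocompact ℝ, P x) :
    ∃ R, 2 ≤ R ∧ ∀ x, R < |x| → P x := by
  rw [cocompact_eq_atBot_atTop, eventually_sup, eventually_atBot, eventually_atTop] at h
  obtain ⟨⟨a, ha⟩, b, hb⟩ := h
  refine ⟨max 2 (max (-a) b), le_max_left _ _, fun x hx => ?_⟩
  have h1 := (le_max_right 2 (max (-a) b)).trans_lt hx
  rcases lt_abs.1 h1 with h | h
  · exact hb x ((le_max_right _ _).trans h.le)
  · exact ha x (by linarith [le_max_left (-a) b])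

lemma exists_increment_le {f : ℝ → ℝ} (hf : ContDiff ℝ 1 f) (R : ℝ) :
    ∃ K > 0, ∀ x h, |x| ≤ R → 0 < h → h ≤ 1 → |f (x + h) - f x| ≤ K * h := by
  obtain ⟨C, hC⟩ := (isCompact_Icc (a := -(R + 1)) (b := R + 1)).exists_bound_of_continuousOn
    (hf.continuous_deriv le_rfl).continuousOn
  refine ⟨|C| + 1, by positivity, fun x h hx h0 h1 => ?_⟩
  rw [abs_le] at hx
  have := (convex_Icc (-(R + 1)) (R + 1)).norm_image_sub_le_of_norm_deriv_le
    (fun s _ => hf.differentiable (by norm_num) s) hC (x := x) (y := x + h)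
    ⟨by linarith, by linarith⟩ ⟨by linarith, by linarith⟩
  simp only [Real.norm_eq_abs, add_sub_cancel_left, abs_of_pos h0] at this
  refine this.trans ?_
  gcongr
  linarith [le_abs_self C]

lemma exists_second_increment_le {f : ℝ → ℝ} (hf : ContDiff ℝ 2 f) (R : ℝ) :
    ∃ K > 0, ∀ x h k, |x| ≤ R → 0 < h → h ≤ 1 → 0 < k → k ≤ 1 →
      |f (x + h + k) - f (x + h) - f (x + k) + f x| ≤ K * h * k := by
  have h1 : ContDiff ℝ 1 (deriv f) := contDiff_deriv (n := 1) (by exact_mod_cast hf)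
  obtain ⟨K, hK, hb⟩ := exists_increment_le h1 (R + 1)
  refine ⟨K, hK, fun x h k hx h0 h1 k0 k1 => ?_⟩
  have hd : ∀ t, HasDerivAt f (deriv f t) t := fun t =>
    (hf.differentiable (by norm_num) t).hasDerivAt
  rw [abs_le] at hx
  have := (convex_Icc x (x + k)).norm_image_sub_le_of_norm_hasDerivWithin_le (C := K * h)
    (f := fun t => f (t + h) - f t) (f' := fun t => deriv f (t + h) - deriv f t)
    (fun t _ => (((hd (t + h)).comp_add_const t h).sub (hd t)).hasDerivWithinAt)
    (fun t ht => hb t h (abs_le.2 ⟨by linarith [ht.1], by linarith [ht.2]⟩) h0 h1)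
    (left_mem_Icc.2 (by linarith)) (right_mem_Icc.2 (by linarith))
  simp only [Real.norm_eq_abs, add_sub_cancel_left, abs_of_pos k0] at this
  calc _ = |f (x + k + h) - f (x + k) - (f (x + h) - f x)| := by
        rw [add_right_comm x h k]; congr 1; ring
    _ ≤ _ := this

lemma abs_deriv_le_of_increment {f : ℝ → ℝ} {x f' c r : ℝ} (hf : HasDerivAt f f' x) (hr : 0 < r)
    (h : ∀ k, 0 < k → k ≤ r → |f (x + k) - f x| ≤ c * k) : |f'| ≤ c := by
  have h1 := (hasDerivAt_iff_tendsto_slope_zero.1 hf).mono_left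
    (nhdsWithin_mono 0 (s := Ioi (0:ℝ)) (fun t (ht : 0 < t) => ht.ne'))
  refine le_of_tendsto h1.abs ?_
  filter_upwards [Ioc_mem_nhdsGT hr] with k hk
  rw [smul_eq_mul, abs_mul, abs_of_pos (inv_pos.2 hk.1), inv_mul_le_iff₀ hk.1, mul_comm]
  exact h k hk.1 hk.2

lemma integrableOn_inv_sq {c : ℝ} (hc : 0 < c) : IntegrableOn (fun z : ℝ => (z ^ 2)⁻¹) (Ioi c) :=
  (integrableOn_Ioi_rpow_of_lt (by norm_num : (-2:ℝ) < -1) hc).congr_fun (fun z hz => by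
    simp only [Real.rpow_neg (hc.trans hz).le, Real.rpow_two]) measurableSet_Ioi

lemma integral_inv_sq {c : ℝ} (hc : 0 < c) : ∫ z in Ioi c, (z ^ 2)⁻¹ = c⁻¹ := by
  have := integral_Ioi_rpow_of_lt (by norm_num : (-2:ℝ) < -1) hc
  rw [show (-2:ℝ) + 1 = -1 by norm_num, Real.rpow_neg_one] at this
  rw [← setIntegral_congr_fun measurableSet_Ioi (fun z hz => ?_), this]
  · ring
  · simp only [Real.rpow_neg (hc.trans hz).le, Real.rpow_two]

/-- Two-sided bound for integrals of functions comparable to a truncation of `1/z²`. -/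
lemma integral_mem_Icc_of_cutoff {f : ℝ → ℝ} {a b : ℝ} (ha : 0 < a) (hb : 0 < b)
    (hf : IntegrableOn f (Ioi 0))
    (hlow : ∀ z, 0 < z → (Ioi b).indicator (fun z => (z ^ 2)⁻¹) z ≤ f z)
    (hup : ∀ z, 0 < z → f z ≤ (Ioi a).indicator (fun z => (z ^ 2)⁻¹) z) :
    (∫ z in Ioi 0, f z) ∈ Icc b⁻¹ a⁻¹ := by
  have hi : ∀ c : ℝ, 0 < c → Integrable ((Ioi c).indicator fun z : ℝ => (z ^ 2)⁻¹) := fun c hc =>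
    (integrable_indicator_iff measurableSet_Ioi).2 (integrableOn_inv_sq hc)
  have hv : ∀ c : ℝ, 0 < c →
      ∫ z in Ioi (0:ℝ), (Ioi c).indicator (fun z : ℝ => (z ^ 2)⁻¹) z = c⁻¹ := fun c hc => by
    rw [setIntegral_indicator measurableSet_Ioi, Ioi_inter_Ioi, max_eq_right hc.le,
      integral_inv_sq hc]
  constructor
  · rw [← hv b hb]
    exact setIntegral_mono_on (hi b hb).integrableOn hf measurableSet_Ioi hlow
  · rw [← hv a ha]
    exact setIntegral_mono_on hf (hi a ha).integrableOn measurableSet_Ioi hup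

lemma bddC2_smoothTransition : BddC2 Real.smoothTransition :=
  ⟨Real.smoothTransition.contDiff (n := 2), 1, fun x => by
    rw [abs_of_nonneg (Real.smoothTransition.nonneg x)]; exact Real.smoothTransition.le_one x⟩

lemma smoothTransition_eq_step {x : ℝ} (hx : 1 ≤ |x|) : Real.smoothTransition x = step x := by
  rcases le_abs.1 hx with h | h
  · rw [step_of_pos (by linarith), Real.smoothTransition.one_of_one_le h, Int.cast_one]
  · rw [step_of_nonpos (by linarith), Real.smoothTransition.zero_of_nonpos (by linarith),
      Int.cast_zero]

lemma inv_sub_lorentzOdd {x : ℝ} (hx : x ≠ 0) : x⁻¹ - lorentzOdd x = x⁻¹ * lorentz x := by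
  have h := lorentz_mul x
  rw [lorentzOdd]
  field_simp
  linarith

lemma inv_sq_le_lorentz {x : ℝ} (hx : 1 ≤ |x|) : (x ^ 2)⁻¹ ≤ 2 * lorentz x := by
  have h1 : 1 ≤ x ^ 2 := by rw [← sq_abs]; nlinarith
  rw [lorentz, ← div_eq_mul_inv, inv_eq_one_div, div_le_div_iff₀ (by positivity) (by positivity)]
  linarith

lemma lorentz_le_inv_sq {x : ℝ} (hx : x ≠ 0) : lorentz x ≤ (x ^ 2)⁻¹ :=
  inv_anti₀ (by positivity) (by linarith)

lemma abs_symLap_smoothTransition_add_le {x : ℝ} (hx : 2 ≤ |x|) :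
    |symLap Real.smoothTransition x + Real.pi⁻¹ * lorentzOdd x| ≤ 5 * lorentz x := by
  set η := Real.smoothTransition with hη
  have h0 : ∀ y, 0 ≤ η y := Real.smoothTransition.nonneg
  have h1 : ∀ y, η y ≤ 1 := Real.smoothTransition.le_one
  have hz : ∀ {y}, y ≤ 0 → η y = 0 := fun h => Real.smoothTransition.zero_of_nonpos h
  have ho : ∀ {y}, 1 ≤ y → η y = 1 := fun h => Real.smoothTransition.one_of_one_le h
  have hint := bddC2_smoothTransition.integrableOn x
  have hpi : Real.pi⁻¹ ≤ 1 := inv_le_one_of_one_le₀ (by linarith [Real.pi_gt_three])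
  have hpi0 := inv_pos.2 Real.pi_pos
  have hl := lorentz_pos x
  have fin : ∀ I y : ℝ, 2 ≤ y → |I - y⁻¹| ≤ 2 * (y ^ 2)⁻¹ →
      |Real.pi⁻¹ * (I - lorentzOdd y)| ≤ 5 * lorentz y := by
    intro I y hy hI
    have h2 := inv_sq_le_lorentz (x := y) (by rw [abs_of_nonneg] <;> linarith)
    have h3 := inv_sub_lorentzOdd (x := y) (by linarith)
    have hl := lorentz_pos y
    have h4 : |y⁻¹ - lorentzOdd y| ≤ lorentz y := by
      rw [h3, abs_of_nonneg (by positivity)]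
      exact mul_le_of_le_one_left hl.le (inv_le_one_of_one_le₀ (by linarith))
    rw [abs_mul, abs_of_pos hpi0]
    calc _ ≤ |I - lorentzOdd y| := mul_le_of_le_one_left (abs_nonneg _) hpi
      _ = |(I - y⁻¹) + (y⁻¹ - lorentzOdd y)| := by congr 1; ring
      _ ≤ |I - y⁻¹| + |y⁻¹ - lorentzOdd y| := abs_add_le _ _
      _ ≤ _ := by linarith
  set I := ∫ z in Ioi (0:ℝ), (η (x + z) + η (x - z) - 2 * η x) / z ^ 2 with hI
  have hs : symLap η x = I / Real.pi := rfl
  rcases le_abs.1 hx with hx | hx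
  · have hm := integral_mem_Icc_of_cutoff (f := fun z => -((η (x + z) + η (x - z) - 2 * η x) / z ^ 2))
      (a := x - 1) (b := x) (by linarith) (by linarith) hint.neg
      (fun z hz' => by
        have e : -((η (x + z) + η (x - z) - 2 * η x) / z ^ 2) = (1 - η (x - z)) * (z ^ 2)⁻¹ := by
          rw [ho (by linarith : 1 ≤ x + z), ho (by linarith : 1 ≤ x)]; ring
        rw [e]
        refine indicator_apply_le' (fun h => ?_) fun h => ?_
        · rw [hz (by linarith [mem_Ioi.1 h] : x - z ≤ 0)]; simp
        · exact mul_nonneg (by linarith [h1 (x - z)]) (by positivity))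
      (fun z hz => by
        have e : -((η (x + z) + η (x - z) - 2 * η x) / z ^ 2) = (1 - η (x - z)) * (z ^ 2)⁻¹ := by
          rw [ho (by linarith : 1 ≤ x + z), ho (by linarith : 1 ≤ x)]; ring
        rw [e]
        refine le_indicator_apply (fun h => ?_) fun h => ?_
        · exact mul_le_of_le_one_left (by positivity) (by linarith [h0 (x - z)])
        · rw [ho (by linarith [not_lt.1 (show ¬ x - 1 < z from h)] : 1 ≤ x - z)]; simp)
    rw [integral_neg, ← hI] at hm
    have := fin (-I) x hx (by
      rw [abs_of_nonneg (by linarith [hm.1])]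
      refine (sub_le_sub_right hm.2 _).trans ?_
      have e1 : x - 1 ≠ 0 := by linarith
      have e2 : x ≠ 0 := by linarith
      rw [inv_sub_inv e1 e2, ← div_eq_mul_inv,
        div_le_div_iff₀ (mul_pos (by linarith) (by linarith)) (by positivity)]
      nlinarith)
    rw [← abs_neg] at this
    convert this using 2
    rw [hs]; ring
  · have hm := integral_mem_Icc_of_cutoff (f := fun z => (η (x + z) + η (x - z) - 2 * η x) / z ^ 2)
      (a := -x) (b := 1 + -x) (by linarith) (by linarith) hint
      (fun z hz' => by
        have e : (η (x + z) + η (x - z) - 2 * η x) / z ^ 2 = η (x + z) * (z ^ 2)⁻¹ := by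
          rw [hz (by linarith : x - z ≤ 0), hz (by linarith : x ≤ 0)]; ring
        rw [e]
        refine indicator_apply_le' (fun h => ?_) fun h => ?_
        · rw [ho (by linarith [mem_Ioi.1 h] : 1 ≤ x + z)]; simp
        · exact mul_nonneg (h0 _) (by positivity))
      (fun z hz' => by
        have e : (η (x + z) + η (x - z) - 2 * η x) / z ^ 2 = η (x + z) * (z ^ 2)⁻¹ := by
          rw [hz (by linarith : x - z ≤ 0), hz (by linarith : x ≤ 0)]; ring
        rw [e]
        refine le_indicator_apply (fun h => ?_) fun h => ?_
        · exact mul_le_of_le_one_left (by positivity) (h1 _)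
        · rw [hz (by linarith [not_lt.1 (show ¬ -x < z from h)] : x + z ≤ 0)]; simp)
    rw [← hI] at hm
    have := fin I (-x) hx (by
      rw [abs_sub_comm, abs_of_nonneg (by linarith [hm.2])]
      refine (sub_le_sub_left hm.1 _).trans ?_
      have e1 : -x ≠ 0 := by linarith
      have e2 : 1 + -x ≠ 0 := by linarith
      rw [inv_sub_inv e1 e2, ← div_eq_mul_inv,
        div_le_div_iff₀ (mul_pos (by linarith) (by linarith)) (by nlinarith)]
      nlinarith)
    have he : lorentz (-x) = lorentz x := by simp [lorentz]
    rw [lorentzOdd, he] at this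
    convert this using 2
    rw [hs, lorentzOdd]; ring

lemma abs_sub_le_of_mem_uIcc' {a b s ρ ξ : ℝ} (ha : |a - s| ≤ ρ) (hb : |b - s| ≤ ρ)
    (h : ξ ∈ uIcc a b) : |ξ - s| ≤ ρ := by
  have := (convex_closedBall s ρ).ordConnected.uIcc_subset (mem_closedBall_iff_norm.2 ha)
    (mem_closedBall_iff_norm.2 hb) h
  exact mem_closedBall_iff_norm.1 this

/-- A bounded transition layer between `0` and `1` driven by the force `F`. -/
structure IsLayer (F φ : ℝ → ℝ) : Prop where
  bddC2 : BddC2 φ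
  eq : ∀ x, symLap φ x = F (φ x)
  lim : Tendsto (fun x => φ x - step x) (cocompact ℝ) (𝓝 0)

lemma tendsto_cocompact_iff {f : ℝ → ℝ} {l : Filter ℝ} :
    Tendsto f (cocompact ℝ) l ↔ Tendsto f atBot l ∧ Tendsto f atTop l := by
  rw [cocompact_eq_atBot_atTop, tendsto_sup]

lemma tendsto_cocompact_comp_add {f : ℝ → ℝ} {l : Filter ℝ} (h : Tendsto f (cocompact ℝ) l) (c : ℝ) :
    Tendsto (fun x => f (x + c)) (cocompact ℝ) l :=
  h.comp (Homeomorph.addRight c).isClosedEmbedding.tendsto_cocompact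

lemma BddC2.of_tendsto {U : ℝ → ℝ} (hU : ContDiff ℝ 2 U) (h : Tendsto U (cocompact ℝ) (𝓝 0)) :
    BddC2 U := by
  refine ⟨hU, ?_⟩
  obtain ⟨R, -, hR⟩ := exists_radius_of_eventually (h.abs.eventually (gt_mem_nhds (by simp :
    |(0:ℝ)| < 1)))
  obtain ⟨C, hC⟩ := (isCompact_Icc (a := -R) (b := R)).exists_bound_of_continuousOn
    hU.continuous.continuousOn
  refine ⟨max C 1, fun x => ?_⟩
  rcases le_or_gt |x| R with hx | hx
  · exact (hC x (abs_le.1 hx)).trans (le_max_left _ _)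
  · exact (hR x hx).le.trans (le_max_right _ _)

lemma IsPhi.isLayer {W φ : ℝ → ℝ} (h : IsPhi W φ) : IsLayer (deriv W) φ := by
  obtain ⟨h4, heq, hbot, htop, -, hpos⟩ := h
  have hmono : Monotone φ := (strictMono_of_deriv_pos hpos).monotone
  have hb : BddC2 φ := ⟨h4.of_le (by norm_num), 1, fun x => by
    rw [abs_of_nonneg (hmono.le_of_tendsto hbot x)]
    exact hmono.ge_of_tendsto htop x⟩
  refine ⟨hb, fun x => by rw [← hb.halfLap_eq, heq], tendsto_cocompact_iff.2 ⟨?_, ?_⟩⟩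
  · refine hbot.congr' ?_
    filter_upwards [eventually_le_atBot 0] with x hx
    simp [step_of_nonpos hx]
  · have := htop.sub_const 1
    rw [sub_self] at this
    refine this.congr' ?_
    filter_upwards [eventually_gt_atTop 0] with x hx
    simp [step_of_pos hx]

lemma tendsto_lorentzOdd_cocompact : Tendsto lorentzOdd (cocompact ℝ) (𝓝 0) := by
  have h : Tendsto (fun x => Real.sqrt (lorentz x)) (cocompact ℝ) (𝓝 0) := by
    simpa using tendsto_lorentz_cocompact.sqrt
  refine squeeze_zero_norm (fun x => ?_) h
  exact Real.abs_le_sqrt (lorentzOdd_sq_le x)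

lemma lorentz_sq_le (x : ℝ) : lorentz x ^ 2 ≤ lorentz x := by
  have := lorentz_le_one x
  have := lorentz_pos x
  nlinarith

section

variable {F G H φ : ℝ → ℝ} {M : ℝ}

/-- Outside a compact set the layer stays in the region where `F' ≥ F'(0)/2`. -/
lemma IsLayer.exists_radius (hφ : IsLayer F φ) (hF : IsForce F G H M) (hα : 0 < G 0) :
    ∃ ρ > 0, ∃ R, 2 ≤ R ∧ (∀ x ξ : ℝ, |ξ - step x| ≤ ρ → G 0 / 2 ≤ G ξ) ∧
      ∀ x, R < |x| → ∀ y, |y - x| ≤ 2 → |φ y - step x| ≤ ρ := by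
  have hM := hF.pos
  refine ⟨G 0 / (2 * M), by positivity, ?_⟩
  obtain ⟨R, hR, h⟩ := exists_radius_of_eventually
    (hφ.lim.abs.eventually (gt_mem_nhds (by simpa using (by positivity : 0 < G 0 / (2 * M)))))
  refine ⟨R + 2, by linarith, fun x ξ hξ => ?_, fun x hx y hy => ?_⟩
  · have h1 := hF.lipG (ξ - step x) 0
    have h2 := hF.G_add_int (ξ - step x) (step x)
    rw [sub_add_cancel] at h2
    rw [← h2, sub_zero] at h1
    have h3 : M * |ξ - step x| ≤ M * (G 0 / (2 * M)) := by gcongr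
    rw [show M * (G 0 / (2 * M)) = G 0 / 2 by field_simp] at h3
    linarith [(abs_le.1 h1).1]
  · rw [← step_eq_of_close (by linarith) hx hy]
    refine (h y ?_).le
    have := abs_sub_abs_le_abs_sub x y
    rw [abs_sub_comm] at this
    linarith

/-- First-order asymptotics of the layer. -/
lemma IsLayer.exists_asymptotics (hφ : IsLayer F φ) (hF : IsForce F G H M) (hα : 0 < G 0) :
    ∃ K > 0, ∀ x, |φ x - Real.smoothTransition x + (Real.pi * G 0)⁻¹ * lorentzOdd x| ≤
      K * lorentz x := by
  set κ := (Real.pi * G 0)⁻¹ with hκ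
  have hκ0 : 0 < κ := inv_pos.2 (mul_pos Real.pi_pos hα)
  have hM := hF.pos
  obtain ⟨ρ, hρ, R, hR, hG, hφR⟩ := hφ.exists_radius hF hα
  obtain ⟨R', hR', hq⟩ := exists_radius_of_eventually
    (tendsto_lorentzOdd_cocompact.abs.eventually (gt_mem_nhds (by simpa using div_pos hρ hκ0)))
  set u : ℝ → ℝ := fun x => Real.smoothTransition x - κ * lorentzOdd x with hu
  have hub : BddC2 u := bddC2_smoothTransition.sub (bddC2_lorentzOdd.const_mul κ)
  have hus : ∀ x, 1 < |x| → u x = -κ * lorentzOdd x + step x := fun x hx => by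
    simp only [hu, smoothTransition_eq_step hx.le]; ring
  set w : ℝ → ℝ := fun x => φ x - u x with hw
  have hwb : BddC2 w := hφ.bddC2.sub hub
  obtain ⟨C, hC, hdec⟩ := exists_abs_decay_le (m := G 0 / 2) (R := max R R') (half_pos hα)
  obtain ⟨Mw, hMw⟩ := hwb.2
  have hMw0 := (abs_nonneg _).trans (hMw 0)
  have hw0 : Tendsto w (cocompact ℝ) (𝓝 0) := by
    have h1 := hφ.lim.add (tendsto_lorentzOdd_cocompact.const_mul κ)
    rw [mul_zero, add_zero] at h1
    have hev : ∀ᶠ x in cocompact ℝ, (1:ℝ) < |x| :=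
      tendsto_norm_cocompact_atTop.eventually (eventually_gt_atTop (1:ℝ))
    refine h1.congr' ?_
    filter_upwards [hev] with x hx
    rw [hw]
    simp only [hus x hx]
    ring
  refine ⟨C * (Mw + (M * κ ^ 2 + 5 + κ)), by positivity, fun x => ?_⟩
  have := hdec w (Mw + (M * κ ^ 2 + 5 + κ)) (by positivity) hwb hw0
    (fun x _ => (hMw x).trans (by linarith [show 0 < M * κ ^ 2 + 5 + κ by positivity]))
    (fun x hx => ?_) x
  · convert this using 2
    simp only [hw, hu]; ring
  have hxR : R < |x| := (le_max_left _ _).trans_lt hx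
  have hqx := hq x ((le_max_right _ _).trans_lt hx)
  have hx1 : 1 < |x| := by linarith
  have hux := hus x hx1
  obtain ⟨ξ, hξ, he⟩ := hF.exists_mvt (u x) (φ x)
  refine ⟨G ξ, hG x ξ (abs_sub_le_of_mem_uIcc' ?_ (hφR x hxR x (by simp)) hξ), ?_⟩
  · rw [hux, add_sub_cancel_right, abs_mul, abs_neg, abs_of_pos hκ0]
    rw [lt_div_iff₀ hκ0] at hqx
    linarith
  have hlap : symLap w x = F (φ x) - (symLap Real.smoothTransition x - κ * symLap lorentzOdd x) := by
    rw [hw, hφ.bddC2.symLap_sub hub, hφ.eq, hu,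
      bddC2_smoothTransition.symLap_sub (bddC2_lorentzOdd.const_mul κ), symLap_const_mul]
  have hFu : F (u x) = F (-κ * lorentzOdd x) := by rw [hux, hF.F_add_int]
  have h1 := hF.abs_F_sub_le (-κ * lorentzOdd x)
  have h2 := abs_symLap_smoothTransition_add_le (x := x) (by linarith)
  have h3 := abs_symLap_lorentzOdd_le x
  have h4 := lorentzOdd_sq_le x
  have hl := lorentz_pos x
  have hακ : G 0 * κ = Real.pi⁻¹ := by rw [hκ]; field_simp
  have e : symLap w x - G ξ * w x = (F (-κ * lorentzOdd x) - G 0 * (-κ * lorentzOdd x))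
      - (symLap Real.smoothTransition x + Real.pi⁻¹ * lorentzOdd x) + κ * symLap lorentzOdd x := by
    rw [hlap, hw, ← he, hFu, ← hακ]; ring
  rw [e]
  have h5 : M * (-κ * lorentzOdd x) ^ 2 ≤ M * κ ^ 2 * lorentz x := by
    rw [mul_pow, neg_sq, ← mul_assoc]; gcongr
  have h6 : |κ * symLap lorentzOdd x| ≤ κ * lorentz x := by
    rw [abs_mul, abs_of_pos hκ0]; gcongr
  have h7 : 0 ≤ Mw * lorentz x := by positivity
  calc _ ≤ |F (-κ * lorentzOdd x) - G 0 * (-κ * lorentzOdd x)|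
      + |symLap Real.smoothTransition x + Real.pi⁻¹ * lorentzOdd x| + |κ * symLap lorentzOdd x| :=
        (abs_add_le _ _).trans (add_le_add_left (abs_sub _ _) _)
    _ ≤ _ := by linarith

lemma BddC2.comp_add {U : ℝ → ℝ} (hU : BddC2 U) (c : ℝ) : BddC2 (fun x => U (x + c)) := by
  simpa using hU.comp_affine 1 c

/-- The increments of the layer decay quadratically. -/
lemma IsLayer.exists_increment_decay (hφ : IsLayer F φ) (hF : IsForce F G H M) (hα : 0 < G 0) :
    ∃ K > 0, ∀ h, 0 < h → h ≤ 1 → ∀ x, |φ (x + h) - φ x| ≤ K * h * lorentz x := by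
  obtain ⟨ρ, hρ, R, hR, hG, hφR⟩ := hφ.exists_radius hF hα
  obtain ⟨C, hC, hdec⟩ := exists_abs_decay_le (m := G 0 / 2) (R := R) (half_pos hα)
  obtain ⟨K, hK, hinc⟩ := exists_increment_le (hφ.bddC2.1.of_le (by norm_num)) R
  refine ⟨C * K, by positivity, fun h h0 h1 x => ?_⟩
  have hb := hφ.bddC2.comp_add h
  have := hdec (fun x => φ (x + h) - φ x) (K * h) (by positivity) (hb.sub hφ.bddC2) ?_
    (fun x hx => hinc x h hx h0 h1) (fun x hx => ?_) x
  · simpa [mul_assoc] using this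
  · have := (tendsto_cocompact_comp_add hφ.lim h).sub hφ.lim
    rw [sub_zero] at this
    refine this.congr' ?_
    filter_upwards [tendsto_norm_cocompact_atTop.eventually (eventually_gt_atTop (2:ℝ))] with x hx
    rw [step_eq_of_close le_rfl hx (y := x + h)]
    · ring
    · rw [add_sub_cancel_left, abs_of_pos h0]; linarith
  · obtain ⟨ξ, hξ, he⟩ := hF.exists_mvt (φ x) (φ (x + h))
    refine ⟨G ξ, hG x ξ (abs_sub_le_of_mem_uIcc' (hφR x hx x (by simp))
      (hφR x hx (x + h) ?_) hξ), ?_⟩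
    · rw [add_sub_cancel_left, abs_of_pos h0]; linarith
    · rw [hb.symLap_sub hφ.bddC2, symLap_comp_add, hφ.eq, hφ.eq, he, sub_self, abs_zero]
      have := lorentz_pos x
      positivity

lemma IsLayer.exists_deriv_decay (hφ : IsLayer F φ) (hF : IsForce F G H M) (hα : 0 < G 0) :
    ∃ K > 0, ∀ x, |deriv φ x| ≤ K * lorentz x := by
  obtain ⟨K, hK, h⟩ := hφ.exists_increment_decay hF hα
  refine ⟨K, hK, fun x => abs_deriv_le_of_increment (hφ.bddC2.hasDerivAt x) one_pos
    fun k k0 k1 => (h k k0 k1 x).trans_eq (by ring)⟩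

/-- The increments of the derivative of the layer decay quadratically. -/
lemma IsLayer.exists_deriv_increment_decay (hφ : IsLayer F φ) (hF : IsForce F G H M)
    (hα : 0 < G 0) :
    ∃ K > 0, ∀ h, 0 < h → h ≤ 1 → ∀ x, |deriv φ (x + h) - deriv φ x| ≤ K * h * lorentz x := by
  obtain ⟨ρ, hρ, R, hR, hG, hφR⟩ := hφ.exists_radius hF hα
  obtain ⟨C, hC, hdec⟩ := exists_abs_decay_le (m := G 0 / 2) (R := R) (half_pos hα)
  obtain ⟨K, hK, hinc⟩ := exists_second_increment_le hφ.bddC2.1 R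
  obtain ⟨K₁, hK₁, hinc₁⟩ := hφ.exists_increment_decay hF hα
  have hM := hF.pos
  have hinc₁' : ∀ h, 0 < h → h ≤ 1 → ∀ x, |φ (x + h) - φ x| ≤ K₁ * h := fun h h0 h1 x =>
    (hinc₁ h h0 h1 x).trans (mul_le_of_le_one_right (by positivity) (lorentz_le_one x))
  refine ⟨C * (K + 3 * M * K₁ ^ 2), by positivity, fun h h0 h1 x => ?_⟩
  refine abs_deriv_le_of_increment
    (((hφ.bddC2.hasDerivAt (x + h)).comp_add_const x h).sub (hφ.bddC2.hasDerivAt x)) h0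
    fun k k0 kh => ?_
  have b1 := hφ.bddC2.comp_add (h + k)
  have b2 := hφ.bddC2.comp_add h
  have b3 := hφ.bddC2.comp_add k
  have := hdec (fun x => (φ (x + (h + k)) - φ (x + h)) - (φ (x + k) - φ x))
    ((K + 3 * M * K₁ ^ 2) * h * k) (by positivity)
    ((b1.sub b2).sub (b3.sub hφ.bddC2)) ?_ (fun x hx => ?_) (fun x hx => ?_) x
  · calc _ = |(φ (x + (h + k)) - φ (x + h)) - (φ (x + k) - φ x)| := by
          rw [show x + (h + k) = x + k + h by ring]
          simp only [Pi.sub_apply]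
          congr 1; ring
      _ ≤ _ := this
      _ = _ := by ring
  · have t := fun c => tendsto_cocompact_comp_add hφ.lim c
    have := ((t (h + k)).sub (t h)).sub ((t k).sub hφ.lim)
    simp only [sub_zero] at this
    refine this.congr' ?_
    filter_upwards [tendsto_norm_cocompact_atTop.eventually (eventually_gt_atTop (2:ℝ))] with x hx
    have hs : ∀ c, 0 ≤ c → c ≤ 2 → step (x + c) = step x := fun c c0 c2 =>
      step_eq_of_close le_rfl hx (by rwa [add_sub_cancel_left, abs_of_nonneg c0])
    rw [hs (h + k) (by linarith) (by linarith), hs h h0.le (by linarith), hs k k0.le (by linarith)]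
    ring
  · have := hinc x h k hx h0 h1 k0 (kh.trans h1)
    calc _ = |φ (x + h + k) - φ (x + h) - φ (x + k) + φ x| := by
          rw [add_assoc x h k]; congr 1; ring
      _ ≤ K * h * k := this
      _ ≤ _ := by gcongr; linarith [show 0 ≤ 3 * M * K₁ ^ 2 by positivity]
  · obtain ⟨ξ, hξ, he⟩ := hF.exists_mvt (φ (x + h)) (φ (x + (h + k)))
    obtain ⟨ζ, hζ, he'⟩ := hF.exists_mvt (φ x) (φ (x + k))
    have hs : ∀ c, 0 ≤ c → c ≤ 2 → |φ (x + c) - step x| ≤ ρ := fun c c0 c2 =>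
      hφR x hx _ (by rwa [add_sub_cancel_left, abs_of_nonneg c0])
    refine ⟨G ξ, hG x ξ (abs_sub_le_of_mem_uIcc' (hs h h0.le (by linarith))
      (hs (h + k) (by linarith) (by linarith)) hξ), ?_⟩
    rw [(b1.sub b2).symLap_sub (b3.sub hφ.bddC2), b1.symLap_sub b2, b3.symLap_sub hφ.bddC2,
      symLap_comp_add, symLap_comp_add, symLap_comp_add, hφ.eq, hφ.eq, hφ.eq, hφ.eq, he, he',
      show ∀ a b c d : ℝ, a * b - c * d - a * (b - d) = (a - c) * d from fun a b c d => by ring,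
      abs_mul]
    have hk := hinc₁ k k0 (kh.trans h1) x
    have hξζ : |ξ - ζ| ≤ 3 * K₁ * h := by
      have d1 := abs_sub_left_of_mem_uIcc hξ
      have d2 := abs_sub_left_of_mem_uIcc hζ
      have d3 := hinc₁' h h0 h1 x
      have d4 := hinc₁' k k0 (kh.trans h1) x
      have d5 := hinc₁' k k0 (kh.trans h1) (x + h)
      rw [add_assoc] at d5
      have d6 : K₁ * k ≤ K₁ * h := by gcongr
      calc |ξ - ζ| = |(ξ - φ (x + h)) + (φ (x + h) - φ x) - (ζ - φ x)| := by congr 1; ring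
        _ ≤ |ξ - φ (x + h)| + |φ (x + h) - φ x| + |ζ - φ x| :=
          (abs_sub _ _).trans (add_le_add_left (abs_add_le _ _) _)
        _ ≤ _ := by linarith
    have hl := lorentz_pos x
    calc _ ≤ (M * (3 * K₁ * h)) * (K₁ * k * lorentz x) := by
          gcongr
          exact (hF.lipG ξ ζ).trans (by gcongr)
      _ = (3 * M * K₁ ^ 2) * h * k * lorentz x := by ring
      _ ≤ _ := by gcongr; linarith

/-- Decaying solutions of the linearised corrector equation. -/
structure IsCorrector (G φ : ℝ → ℝ) (l c : ℝ) (ψ : ℝ → ℝ) : Prop where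
  bddC2 : BddC2 ψ
  eq : ∀ x, symLap ψ x = G (φ x) * ψ x + l * (G (φ x) - G 0) + c * deriv φ x
  lim : Tendsto ψ (cocompact ℝ) (𝓝 0)

lemma IsPsi.isCorrector {W φ ψ : ℝ → ℝ} {L : ℝ} (h : IsPsi W φ L ψ) :
    IsCorrector (deriv (deriv W)) φ (L / deriv (deriv W) 0) (L / ∫ y : ℝ, (deriv φ y) ^ 2) ψ := by
  obtain ⟨h3, heq, hbot, htop⟩ := h
  have ht := tendsto_cocompact_iff.2 ⟨hbot, htop⟩
  have hb := BddC2.of_tendsto (h3.of_le (by norm_num)) ht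
  exact ⟨hb, fun x => by rw [← hb.halfLap_eq, heq], ht⟩

lemma IsCorrector.exists_asymptotics {ψ : ℝ → ℝ} {l c : ℝ} (hψ : IsCorrector G φ l c ψ)
    (hφ : IsLayer F φ) (hF : IsForce F G H M) (hα : 0 < G 0) :
    ∃ k, ∃ K > 0, ∀ x, |ψ x - k * lorentzOdd x| ≤ K * lorentz x := by
  obtain ⟨ρ, hρ, R, hR, hG, hφR⟩ := hφ.exists_radius hF hα
  obtain ⟨C, hC, hdec⟩ := exists_abs_decay_le (m := G 0 / 2) (R := R) (half_pos hα)
  obtain ⟨K₁, hK₁, has⟩ := hφ.exists_asymptotics hF hα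
  obtain ⟨K₂, hK₂, hder⟩ := hφ.exists_deriv_decay hF hα
  have hM := hF.pos
  set κ := (Real.pi * G 0)⁻¹ with hκ
  set k := l * H 0 * κ / G 0 with hk
  set w : ℝ → ℝ := fun x => ψ x - k * lorentzOdd x with hw
  have hwb : BddC2 w := hψ.bddC2.sub (bddC2_lorentzOdd.const_mul k)
  have hw0 : Tendsto w (cocompact ℝ) (𝓝 0) := by
    simpa using hψ.lim.sub (tendsto_lorentzOdd_cocompact.const_mul k)
  obtain ⟨Mw, hMw⟩ := hwb.2
  have hMw0 := (abs_nonneg _).trans (hMw 0)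
  set E := |H 0| * K₁ + M * (2 * κ ^ 2 + 2 * K₁ ^ 2) with hE
  have hE0 : 0 < E := by positivity
  set B := (|k| + |l|) * E + |k * H 0 * κ| + |c| * K₂ + |k| with hB
  have hB0 : 0 ≤ B := by positivity
  refine ⟨k, C * (Mw + B + 1), by positivity, fun x => ?_⟩
  refine hdec w (Mw + B + 1) (by positivity) hwb hw0 (fun x _ => (hMw x).trans (by linarith))
    (fun x hx => ⟨G (φ x), hG x _ (hφR x hx x (by simp)), ?_⟩) x
  have hl := lorentz_pos x
  have hx1 : 1 < |x| := by linarith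
  set q := lorentzOdd x with hq
  have hq2 : q ^ 2 ≤ lorentz x := lorentzOdd_sq_le x
  have hq1 : |q| ≤ 1 := abs_lorentzOdd_le x
  set t := φ x - step x with ht
  have hGt : G (φ x) = G t := by
    rw [← hF.G_add_int t (step x), ht, sub_add_cancel]
  have hte : |t + κ * q| ≤ K₁ * lorentz x := by
    have := has x
    rwa [smoothTransition_eq_step hx1.le] at this
  have ht2 : t ^ 2 ≤ (2 * κ ^ 2 + 2 * K₁ ^ 2) * lorentz x := by
    have e1 : (t + κ * q) ^ 2 ≤ K₁ ^ 2 * lorentz x := by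
      rw [← sq_abs]
      calc _ ≤ (K₁ * lorentz x) ^ 2 := by gcongr
        _ = K₁ ^ 2 * lorentz x ^ 2 := by ring
        _ ≤ _ := by gcongr; exact lorentz_sq_le x
    have e2 : κ ^ 2 * q ^ 2 ≤ κ ^ 2 * lorentz x := by gcongr
    nlinarith [sq_nonneg (t + κ * q + κ * q)]
  have hGe : |G t - G 0 + H 0 * κ * q| ≤ E * lorentz x := by
    calc _ = |(G t - G 0 - H 0 * t) + H 0 * (t + κ * q)| := by congr 1; ring
      _ ≤ |G t - G 0 - H 0 * t| + |H 0 * (t + κ * q)| := abs_add_le _ _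
      _ ≤ M * ((2 * κ ^ 2 + 2 * K₁ ^ 2) * lorentz x) + |H 0| * (K₁ * lorentz x) := by
        rw [abs_mul]
        gcongr
        exact (hF.abs_G_sub_le t).trans (by gcongr)
      _ = _ := by rw [hE]; ring
  have hkα : k * G 0 = l * H 0 * κ := by rw [hk]; field_simp
  have e : symLap w x - G (φ x) * w x = (k * q + l) * (G t - G 0 + H 0 * κ * q)
      - k * H 0 * κ * q ^ 2 + c * deriv φ x - k * symLap lorentzOdd x := by
    rw [hw, hψ.bddC2.symLap_sub (bddC2_lorentzOdd.const_mul k), symLap_const_mul, hψ.eq, hGt]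
    linear_combination q * hkα
  rw [e]
  have a1 : |(k * q + l) * (G t - G 0 + H 0 * κ * q)| ≤ (|k| + |l|) * (E * lorentz x) := by
    rw [abs_mul]
    gcongr
    refine (abs_add_le _ _).trans ?_
    rw [abs_mul]
    gcongr
    exact mul_le_of_le_one_right (abs_nonneg k) hq1
  have a2 : |k * H 0 * κ * q ^ 2| ≤ |k * H 0 * κ| * lorentz x := by
    rw [abs_mul, abs_of_nonneg (sq_nonneg q)]; gcongr
  have a3 : |c * deriv φ x| ≤ |c| * (K₂ * lorentz x) := by
    rw [abs_mul]; gcongr; exact hder x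
  have a4 : |k * symLap lorentzOdd x| ≤ |k| * lorentz x := by
    rw [abs_mul]; gcongr; exact abs_symLap_lorentzOdd_le x
  have a5 : 0 ≤ Mw * lorentz x := by positivity
  calc _ ≤ |(k * q + l) * (G t - G 0 + H 0 * κ * q)| + |k * H 0 * κ * q ^ 2| + |c * deriv φ x|
      + |k * symLap lorentzOdd x| := by
        refine (abs_sub _ _).trans (add_le_add_left ((abs_add_le _ _).trans
          (add_le_add_left (abs_sub _ _) _)) _)
    _ ≤ _ := by rw [hB]; linarith

lemma IsCorrector.exists_deriv_decay {ψ : ℝ → ℝ} {l c : ℝ} (hψ : IsCorrector G φ l c ψ)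
    (hφ : IsLayer F φ) (hF : IsForce F G H M) (hα : 0 < G 0) :
    ∃ K > 0, ∀ x, |deriv ψ x| ≤ K * lorentz x := by
  obtain ⟨ρ, hρ, R, hR, hG, hφR⟩ := hφ.exists_radius hF hα
  obtain ⟨C, hC, hdec⟩ := exists_abs_decay_le (m := G 0 / 2) (R := R) (half_pos hα)
  obtain ⟨K, hK, hinc⟩ := exists_increment_le (hψ.bddC2.1.of_le (by norm_num)) R
  obtain ⟨K₁, hK₁, hinc₁⟩ := hφ.exists_increment_decay hF hα
  obtain ⟨K₂, hK₂, hinc₂⟩ := hφ.exists_deriv_increment_decay hF hα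
  obtain ⟨N, hN⟩ := hψ.bddC2.2
  have hN0 := (abs_nonneg _).trans (hN 0)
  have hM := hF.pos
  set B := (N + |l|) * (M * K₁) + |c| * K₂ with hB
  have hB0 : 0 ≤ B := by positivity
  refine ⟨C * (K + B), by positivity, fun x => abs_deriv_le_of_increment (hψ.bddC2.hasDerivAt x)
    one_pos fun h h0 h1 => ?_⟩
  have hb := hψ.bddC2.comp_add h
  have := hdec (fun x => ψ (x + h) - ψ x) ((K + B) * h) (by positivity) (hb.sub hψ.bddC2)
    (by simpa using (tendsto_cocompact_comp_add hψ.lim h).sub hψ.lim)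
    (fun x hx => (hinc x h hx h0 h1).trans (by gcongr; linarith)) (fun x hx => ?_) x
  · exact this.trans_eq (by ring)
  refine ⟨G (φ (x + h)), hG x _ (hφR x hx _ ?_), ?_⟩
  · rw [add_sub_cancel_left, abs_of_pos h0]; linarith
  rw [hb.symLap_sub hψ.bddC2, symLap_comp_add, hψ.eq, hψ.eq]
  have hl := lorentz_pos x
  have a1 : |G (φ (x + h)) - G (φ x)| ≤ M * (K₁ * h * lorentz x) :=
    (hF.lipG _ _).trans (by gcongr; exact hinc₁ h h0 h1 x)
  have a2 : |ψ x + l| ≤ N + |l| := (abs_add_le _ _).trans (by gcongr; exact hN x)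
  calc _ = |(ψ x + l) * (G (φ (x + h)) - G (φ x)) + c * (deriv φ (x + h) - deriv φ x)| := by
        congr 1; ring
    _ ≤ |(ψ x + l) * (G (φ (x + h)) - G (φ x))| + |c * (deriv φ (x + h) - deriv φ x)| :=
        abs_add_le _ _
    _ ≤ (N + |l|) * (M * (K₁ * h * lorentz x)) + |c| * (K₂ * h * lorentz x) := by
        rw [abs_mul, abs_mul]
        gcongr
        exact hinc₂ h h0 h1 x
    _ = B * h * lorentz x := by rw [hB]; ring
    _ ≤ _ := by gcongr; linarith

end

/-- Convergence of the symmetric partial sums over `ℤ`. -/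
def HasSymSum (u : ℤ → ℝ) (a : ℝ) : Prop :=
  Tendsto (fun n : ℕ => ∑ i ∈ Finset.Icc (-(n:ℤ)) (n:ℤ), u i) atTop (𝓝 a)

namespace HasSymSum

variable {u v : ℤ → ℝ} {a b : ℝ}

lemma add (hu : HasSymSum u a) (hv : HasSymSum v b) :
    HasSymSum (fun i => u i + v i) (a + b) := by
  simpa only [HasSymSum, Finset.sum_add_distrib] using Tendsto.add hu hv

lemma const_mul (hu : HasSymSum u a) (c : ℝ) : HasSymSum (fun i => c * u i) (c * a) := by
  simpa only [HasSymSum, Finset.mul_sum] using Tendsto.const_mul c hu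

lemma single (k : ℤ) (a : ℝ) : HasSymSum (fun i => if i = k then a else 0) a := by
  refine tendsto_const_nhds.congr' ?_
  filter_upwards [eventually_ge_atTop k.natAbs] with n hn
  rw [Finset.sum_ite_eq', if_pos (Finset.mem_Icc.2 (by omega))]

lemma inv_sub (k : ℤ) : HasSymSum (fun i => ((i:ℝ) - k)⁻¹) 0 := by
  have shift : ∀ (f : ℤ → ℝ) (n : ℕ), ∑ i ∈ Finset.Icc (-(n:ℤ)) n, f (i - 1) =
      ∑ i ∈ Finset.Icc (-(n:ℤ)) n, f i + f (-n - 1) - f n := by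
    intro f n
    induction n with
    | zero => simp
    | succ n ih =>
      have e : Finset.Icc (-((n + 1 : ℕ) : ℤ)) ((n + 1 : ℕ) : ℤ) =
          insert ((n:ℤ) + 1) (insert (-(n:ℤ) - 1) (Finset.Icc (-(n:ℤ)) n)) := by
        ext i
        simp only [Finset.mem_Icc, Finset.mem_insert]
        omega
      have m1 : -(n:ℤ) - 1 ∉ Finset.Icc (-(n:ℤ)) n := by simp
      have m2 : (n:ℤ) + 1 ∉ insert (-(n:ℤ) - 1) (Finset.Icc (-(n:ℤ)) n) := by
        simp only [Finset.mem_Icc, Finset.mem_insert]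
        omega
      rw [e, Finset.sum_insert m2, Finset.sum_insert m1, Finset.sum_insert m2,
        Finset.sum_insert m1, ih]
      push_cast
      rw [show (n:ℤ) + 1 - 1 = n by ring, show -((n:ℤ) + 1) - 1 = -n - 1 - 1 by ring]
      ring
  have t1 : ∀ c : ℝ, Tendsto (fun n : ℕ => ((n:ℝ) + c)⁻¹) atTop (𝓝 0) := fun c =>
    tendsto_inv_atTop_zero.comp (tendsto_atTop_add_const_right _ c tendsto_natCast_atTop_atTop)
  have key : ∀ k : ℤ, Tendsto (fun n : ℕ => ∑ i ∈ Finset.Icc (-(n:ℤ)) n, ((i:ℝ) - (k + 1 : ℤ))⁻¹ -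
      ∑ i ∈ Finset.Icc (-(n:ℤ)) n, ((i:ℝ) - k)⁻¹) atTop (𝓝 0) := by
    intro k
    have h := ((t1 (1 + k)).neg).sub (t1 (-k))
    rw [neg_zero, sub_zero] at h
    refine h.congr fun n => ?_
    have := shift (fun i => ((i:ℝ) - k)⁻¹) n
    push_cast at this ⊢
    simp only [sub_sub, add_comm (1:ℝ) (k:ℝ)] at this ⊢
    rw [this, ← inv_neg]
    ring_nf
  induction k using Int.induction_on with
  | zero =>
    refine tendsto_const_nhds.congr fun n => ?_
    have h : ∑ i ∈ Finset.Icc (-(n:ℤ)) n, ((i:ℝ) - (0:ℤ))⁻¹ =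
        ∑ i ∈ Finset.Icc (-(n:ℤ)) n, -((i:ℝ) - (0:ℤ))⁻¹ := by
      refine Finset.sum_equiv (Equiv.neg ℤ) (fun i => ?_) fun i _ => ?_
      · simp only [Finset.mem_Icc, Equiv.neg_apply]
        omega
      · simp [inv_neg]
    rw [Finset.sum_neg_distrib] at h
    linarith
  | succ k ih =>
    have h := Tendsto.add ih (key k)
    rw [add_zero] at h
    refine h.congr fun n => ?_
    rw [add_sub_cancel]
  | pred k ih =>
    have h := Tendsto.sub ih (key (-k - 1))
    rw [sub_zero] at h
    refine h.congr fun n => ?_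
    rw [sub_add_cancel, sub_sub_cancel]

end HasSymSum

/-- The sum of the inverse squares of the nonzero integers. -/
def invSqSum : ℝ := ∑' j : ℤ, ((j:ℝ) ^ 2)⁻¹

lemma summable_int_inv_sq : Summable fun j : ℤ => ((j:ℝ) ^ 2)⁻¹ := by
  simpa using Real.summable_one_div_int_pow.2 (by norm_num : 1 < 2)

lemma invSqSum_nonneg : 0 ≤ invSqSum := tsum_nonneg fun j => by positivity

lemma exists_hasSymSum_of_abs_le {u : ℤ → ℝ} {A : ℝ} (k : ℤ)
    (hu : ∀ i, |u i| ≤ A * (((i:ℝ) - k) ^ 2)⁻¹) : ∃ a, HasSymSum u a ∧ |a| ≤ A * invSqSum := by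
  have hs : HasSum (fun i : ℤ => A * (((i:ℝ) - k) ^ 2)⁻¹) (A * invSqSum) := by
    refine HasSum.mul_left A ?_
    simpa [Function.comp_def, invSqSum] using
      (Equiv.subRight k).hasSum_iff.2 summable_int_inv_sq.hasSum
  have hsum : Summable u := Summable.of_norm_bounded (E := ℝ) hs.summable hu
  refine ⟨∑' i, u i, ?_, tsum_of_norm_bounded (E := ℝ) hs hu⟩
  exact hsum.hasSum.comp Finset.tendsto_Icc_neg

lemma exists_hasSymSum_of_abs_sub_inv_le {u : ℤ → ℝ} {A : ℝ} (k : ℤ) (κ : ℝ)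
    (hu : ∀ i, |u i - κ * ((i:ℝ) - k)⁻¹| ≤ A * (((i:ℝ) - k) ^ 2)⁻¹) :
    ∃ a, HasSymSum u a ∧ |a| ≤ A * invSqSum := by
  obtain ⟨a, ha, hle⟩ := exists_hasSymSum_of_abs_le k hu
  refine ⟨a, ?_, hle⟩
  simpa using ha.add ((HasSymSum.inv_sub k).const_mul κ)

lemma tendsto_sum_heaviside_sub (k : ℤ) :
    Tendsto (fun n : ℕ => ∑ i ∈ Finset.Icc (-(n:ℤ)) n, (if i < k then (1:ℝ) else 0) - n)
      atTop (𝓝 k) := by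
  refine tendsto_const_nhds.congr' ?_
  filter_upwards [eventually_ge_atTop k.natAbs] with n hn
  have e : (Finset.Icc (-(n:ℤ)) n).filter (· < k) = Finset.Ico (-(n:ℤ)) k := by
    ext i
    simp only [Finset.mem_filter, Finset.mem_Icc, Finset.mem_Ico]
    omega
  have hc : (((k + n).toNat : ℤ) : ℝ) = k + n := by
    rw [Int.toNat_of_nonneg (by omega)]
    push_cast
    ring
  rw [Finset.sum_boole, e, Int.card_Ico, sub_neg_eq_add]
  push_cast at hc ⊢
  linarith

section

variable {F G H φ ψ : ℝ → ℝ} {M : ℝ}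

lemma abs_inv_sub_lorentzOdd_le {x : ℝ} (hx : 1 ≤ |x|) : |x⁻¹ - lorentzOdd x| ≤ (x ^ 2)⁻¹ := by
  have h0 : x ≠ 0 := abs_pos.1 (by linarith)
  rw [inv_sub_lorentzOdd h0, abs_mul, abs_of_pos (lorentz_pos x), abs_inv]
  exact (mul_le_of_le_one_left (lorentz_pos x).le (inv_le_one_of_one_le₀ hx)).trans
    (lorentz_le_inv_sq h0)

lemma IsLayer.exists_expansion (hφ : IsLayer F φ) (hF : IsForce F G H M) (hα : 0 < G 0) :
    ∃ κ, ∃ K > 0, ∀ z, 1 ≤ |z| → |φ z - step z + κ * z⁻¹| ≤ K * (z ^ 2)⁻¹ := by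
  obtain ⟨K, hK, h⟩ := hφ.exists_asymptotics hF hα
  set κ := (Real.pi * G 0)⁻¹
  refine ⟨κ, K + |κ|, by positivity, fun z hz => ?_⟩
  have h0 : z ≠ 0 := abs_pos.1 (by linarith)
  have h1 := h z
  rw [smoothTransition_eq_step hz] at h1
  calc |φ z - step z + κ * z⁻¹|
      = |(φ z - step z + κ * lorentzOdd z) + κ * (z⁻¹ - lorentzOdd z)| := by ring_nf
    _ ≤ K * lorentz z + |κ| * |z⁻¹ - lorentzOdd z| := by
        rw [← abs_mul]; exact (abs_add_le _ _).trans (by gcongr)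
    _ ≤ (K + |κ|) * (z ^ 2)⁻¹ := by
        rw [add_mul]
        have := lorentz_le_inv_sq h0
        have := abs_inv_sub_lorentzOdd_le hz
        gcongr

lemma IsCorrector.exists_expansion {l c : ℝ} (hψ : IsCorrector G φ l c ψ)
    (hφ : IsLayer F φ) (hF : IsForce F G H M) (hα : 0 < G 0) :
    ∃ k, ∃ K > 0, ∀ z, 1 ≤ |z| → |ψ z + k * z⁻¹| ≤ K * (z ^ 2)⁻¹ := by
  obtain ⟨k, K, hK, h⟩ := hψ.exists_asymptotics hφ hF hα
  refine ⟨-k, K + |k|, by positivity, fun z hz => ?_⟩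
  have h0 : z ≠ 0 := abs_pos.1 (by linarith)
  calc |ψ z + -k * z⁻¹| = |(ψ z - k * lorentzOdd z) - k * (z⁻¹ - lorentzOdd z)| := by ring_nf
    _ ≤ K * lorentz z + |k| * |z⁻¹ - lorentzOdd z| := by
        rw [← abs_mul]; exact (abs_sub _ _).trans (add_le_add (h z) le_rfl)
    _ ≤ (K + |k|) * (z ^ 2)⁻¹ := by
        rw [add_mul]
        have := lorentz_le_inv_sq h0
        have := abs_inv_sub_lorentzOdd_le hz
        gcongr

/-- The stiffness deviation `G(φ) - G(0)` decays at least like `1/|z|`. -/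
lemma IsLayer.exists_stiffness_decay (hφ : IsLayer F φ) (hF : IsForce F G H M) (hα : 0 < G 0) :
    ∃ K > 0, ∀ z, |G (φ z) - G 0| * |z| ≤ K := by
  obtain ⟨κ, K, hK, h⟩ := hφ.exists_expansion hF hα
  have hM := hF.pos
  refine ⟨2 * M + M * (K + |κ|), by positivity, fun z => ?_⟩
  rcases le_or_gt 1 |z| with hz | hz
  · have hz0 : 0 < |z| := by linarith
    have e : G (φ z) - G 0 = G (φ z - step z) - G 0 := by
      rw [← hF.G_add_int (φ z - step z) (step z), sub_add_cancel]
    have h1 : |φ z - step z| ≤ (K + |κ|) * |z|⁻¹ := by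
      calc |φ z - step z| = |(φ z - step z + κ * z⁻¹) - κ * z⁻¹| := by ring_nf
        _ ≤ K * (z ^ 2)⁻¹ + |κ| * |z|⁻¹ := by
          rw [← abs_inv, ← abs_mul]; exact (abs_sub _ _).trans (add_le_add (h z hz) le_rfl)
        _ ≤ (K + |κ|) * |z|⁻¹ := by
          rw [add_mul, ← sq_abs]
          gcongr
          nlinarith
    have h2 := hF.lipG (φ z - step z) 0
    rw [← e, sub_zero] at h2
    calc |G (φ z) - G 0| * |z| ≤ M * ((K + |κ|) * |z|⁻¹) * |z| := by
          gcongr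
          exact h2.trans (by gcongr)
      _ = M * (K + |κ|) := by field_simp
      _ ≤ _ := by linarith
  · have h2 : |G (φ z) - G 0| ≤ 2 * M :=
      (abs_sub _ _).trans (by linarith [hF.boundG (φ z), hF.boundG 0])
    calc |G (φ z) - G 0| * |z| ≤ 2 * M * 1 := by gcongr
      _ ≤ _ := by nlinarith [abs_nonneg κ, mul_pos hM hK, mul_nonneg hM.le (abs_nonneg κ)]

end

section

variable {ε γ : ℝ} {j : ℤ}

lemma half_abs_le_abs_sub (hγ : |γ| ≤ 1 / 2) (hj : j ≠ 0) : |(j:ℝ)| / 2 ≤ |γ - j| := by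
  have h1 : (1:ℝ) ≤ |(j:ℝ)| := by exact_mod_cast Int.one_le_abs hj
  have := abs_sub_abs_le_abs_sub (j:ℝ) γ
  rw [abs_sub_comm] at this
  linarith

lemma one_le_abs_rescaled (hε : 0 < ε) (hε1 : ε ≤ 1 / 2) (hγ : |γ| ≤ 1 / 2) (hj : j ≠ 0) :
    1 ≤ |(γ - j) / ε| := by
  have h1 : (1:ℝ) ≤ |(j:ℝ)| := by exact_mod_cast Int.one_le_abs hj
  rw [abs_div, abs_of_pos hε, one_le_div hε]
  linarith [half_abs_le_abs_sub hγ hj]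

lemma inv_sq_rescaled_le (hε : 0 < ε) (hγ : |γ| ≤ 1 / 2) (hj : j ≠ 0) :
    (((γ - j) / ε) ^ 2)⁻¹ ≤ 4 * ε ^ 2 * ((j:ℝ) ^ 2)⁻¹ := by
  have h1 := half_abs_le_abs_sub hγ hj
  have hj0 : 0 < |(j:ℝ)| := abs_pos.2 (Int.cast_ne_zero.2 hj)
  rw [div_pow, inv_div, ← sq_abs (γ - j), ← sq_abs (j:ℝ)]
  calc ε ^ 2 / |γ - j| ^ 2 ≤ ε ^ 2 / (|(j:ℝ)| / 2) ^ 2 := by gcongr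
    _ = _ := by field_simp; norm_num

lemma abs_inv_rescaled_add_le (hε : 0 < ε) (hγ : |γ| ≤ 1 / 2) (hj : j ≠ 0) :
    |((γ - j) / ε)⁻¹ + ε * (j:ℝ)⁻¹| ≤ 2 * ε * |γ| * ((j:ℝ) ^ 2)⁻¹ := by
  have h1 := half_abs_le_abs_sub hγ hj
  have hj0 : (j:ℝ) ≠ 0 := Int.cast_ne_zero.2 hj
  have hj1 : 0 < |(j:ℝ)| := abs_pos.2 hj0
  have hg : γ - j ≠ 0 := abs_pos.1 (by linarith)
  have e : ((γ - j) / ε)⁻¹ + ε * (j:ℝ)⁻¹ = ε * γ / ((γ - j) * j) := by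
    field_simp
    ring
  rw [e, abs_div, abs_mul, abs_mul, abs_of_pos hε, ← sq_abs (j:ℝ)]
  calc ε * |γ| / (|γ - j| * |(j:ℝ)|) ≤ ε * |γ| / (|(j:ℝ)| / 2 * |(j:ℝ)|) := by gcongr
    _ = _ := by field_simp

lemma step_rescaled (hε : 0 < ε) (hγ : |γ| ≤ 1 / 2) (hj : j ≠ 0) :
    step ((γ - j) / ε) = if j < 0 then 1 else 0 := by
  rw [abs_le] at hγ
  split_ifs with h
  · have : (j:ℝ) ≤ -1 := by exact_mod_cast Int.le_sub_one_of_lt h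
    exact step_of_pos (div_pos (by linarith) hε)
  · have : (1:ℝ) ≤ j := by exact_mod_cast (by omega : 1 ≤ j)
    exact step_of_nonpos (div_nonpos_of_nonpos_of_nonneg (by linarith) hε.le)

/-- Sampling a profile with expansion `-κ/z + O(z⁻²)` along a scaled lattice. -/
lemma abs_rescaled_sub_le {f : ℝ → ℝ} {κ K : ℝ} (hK : 0 < K)
    (hf : ∀ z, 1 ≤ |z| → |f z + κ * z⁻¹| ≤ K * (z ^ 2)⁻¹)
    (hε : 0 < ε) (hε1 : ε ≤ 1 / 2) (hγ : |γ| ≤ 1 / 2) (j : ℤ) :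
    |(if j = 0 then 0 else f ((γ - j) / ε)) - κ * ε * (j:ℝ)⁻¹| ≤
      (2 * |κ| * (ε * |γ|) + 4 * K * ε ^ 2) * ((j:ℝ) ^ 2)⁻¹ := by
  rcases eq_or_ne j 0 with rfl | hj
  · simp
  rw [if_neg hj]
  set z := (γ - j) / ε
  calc |f z - κ * ε * (j:ℝ)⁻¹| = |(f z + κ * z⁻¹) - κ * (z⁻¹ + ε * (j:ℝ)⁻¹)| := by ring_nf
    _ ≤ K * (z ^ 2)⁻¹ + |κ| * |z⁻¹ + ε * (j:ℝ)⁻¹| := by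
        rw [← abs_mul]
        exact (abs_sub _ _).trans
          (add_le_add (hf z (one_le_abs_rescaled hε hε1 hγ hj)) le_rfl)
    _ ≤ K * (4 * ε ^ 2 * ((j:ℝ) ^ 2)⁻¹) + |κ| * (2 * ε * |γ| * ((j:ℝ) ^ 2)⁻¹) := by
        have h1 : (z ^ 2)⁻¹ ≤ _ := inv_sq_rescaled_le hε hγ hj
        have h2 : |z⁻¹ + ε * (j:ℝ)⁻¹| ≤ _ := abs_inv_rescaled_add_le hε hγ hj
        gcongr
    _ = _ := by ring

lemma abs_rescaled_le {f : ℝ → ℝ} {κ K : ℝ} (hK : 0 < K)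
    (hf : ∀ z, 1 ≤ |z| → |f z + κ * z⁻¹| ≤ K * (z ^ 2)⁻¹)
    (hε : 0 < ε) (hε1 : ε ≤ 1 / 2) (hγ : |γ| ≤ 1 / 2) (j : ℤ) :
    |if j = 0 then 0 else f ((γ - j) / ε)| ≤ (2 * |κ| + 2 * K) * ε * |(j:ℝ)|⁻¹ := by
  have h := abs_rescaled_sub_le hK hf hε hε1 hγ j
  set p := if j = 0 then 0 else f ((γ - j) / ε)
  have hsq : ((j:ℝ) ^ 2)⁻¹ ≤ |(j:ℝ)|⁻¹ := by
    rcases eq_or_ne j 0 with rfl | hj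
    · simp
    have h1 : (1:ℝ) ≤ |(j:ℝ)| := by exact_mod_cast Int.one_le_abs hj
    rw [← sq_abs]
    gcongr
    nlinarith
  calc |p| = |(p - κ * ε * (j:ℝ)⁻¹) + κ * ε * (j:ℝ)⁻¹| := by rw [sub_add_cancel]
    _ ≤ (2 * |κ| * (ε * |γ|) + 4 * K * ε ^ 2) * ((j:ℝ) ^ 2)⁻¹ + |κ| * ε * |(j:ℝ)|⁻¹ := by
        refine (abs_add_le _ _).trans (add_le_add h ?_)
        rw [abs_mul, abs_mul, abs_of_pos hε, abs_inv]
    _ ≤ (2 * |κ| * (ε * (1 / 2)) + 4 * K * (ε * (1 / 2))) * |(j:ℝ)|⁻¹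
          + |κ| * ε * |(j:ℝ)|⁻¹ := by
        rw [sq ε]
        gcongr
    _ = _ := by ring

end

/-- Limits of the lattice sums entering the equation, compared with the values `Y`, `Z` of the
layer and the corrector at the nearest lattice point. -/
lemma exists_lattice_limits {F G H φ ψ : ℝ → ℝ} {M l c : ℝ} (hF : IsForce F G H M)
    (hα : 0 < G 0) (hφ : IsLayer F φ) (hψ : IsCorrector G φ l c ψ) :
    ∃ C > 0, ∀ ε, 0 < ε → ε ≤ 1 / 2 → ∀ x : ℝ, ∃ Y Z P Q A B D E : ℝ,
      Tendsto (fun n : ℕ => ∑ i ∈ Finset.Icc (-(n:ℤ)) n, φ ((x - i) / ε) - n) atTop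
        (𝓝 (round x + Y + P)) ∧
      HasSymSum (fun i => ψ ((x - i) / ε)) (Z + Q) ∧
      HasSymSum (fun i => F (φ ((x - i) / ε))) (F Y + G 0 * P + A) ∧
      HasSymSum (fun i => G (φ ((x - i) / ε)) * ψ ((x - i) / ε)) (G Y * Z + G 0 * Q + B) ∧
      HasSymSum (fun i => G (φ ((x - i) / ε)) - G 0) (G Y - G 0 + H 0 * P + D) ∧
      HasSymSum (fun i => deriv ψ ((x - i) / ε)) E ∧
      |Z| ≤ C ∧ |E| ≤ C ∧ |P| ≤ C * ε ∧ |Q| ≤ C * ε ∧ |(G Y - G 0) * P| ≤ C * ε ^ 2 ∧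
      |A| ≤ C * ε ^ 2 ∧ |B| ≤ C * ε ^ 2 ∧ |D| ≤ C * ε ^ 2 := by
  obtain ⟨κ, K₁, hK₁, h₁⟩ := hφ.exists_expansion hF hα
  obtain ⟨k, K₂, hK₂, h₂⟩ := hψ.exists_expansion hφ hF hα
  obtain ⟨K₃, hK₃, h₃⟩ := hψ.exists_deriv_decay hφ hF hα
  obtain ⟨K₄, hK₄, h₄⟩ := hφ.exists_stiffness_decay hF hα
  obtain ⟨-, K₅, h₅⟩ := hψ.bddC2
  have hK₅ : 0 ≤ K₅ := (abs_nonneg _).trans (h₅ 0)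
  have hM := hF.pos
  have hS := invSqSum_nonneg
  set S := invSqSum
  set a := 2 * |κ| + 2 * K₁
  set b := 2 * |k| + 2 * K₂
  have ha : 0 ≤ a := by positivity
  have hb : 0 ≤ b := by positivity
  refine ⟨K₅ + (K₃ + K₃ * S) + a * S + b * S + (2 * |κ| * S * K₄ + 8 * M * K₁ * S) +
    M * a ^ 2 * S + M * a * b * S, by positivity, fun ε hε hε1 x => ?_⟩
  set C := K₅ + (K₃ + K₃ * S) + a * S + b * S + (2 * |κ| * S * K₄ + 8 * M * K₁ * S) +
    M * a ^ 2 * S + M * a * b * S with hC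
  have hterms : K₅ ≤ C ∧ K₃ + K₃ * S ≤ C ∧ a * S ≤ C ∧ b * S ≤ C ∧
      2 * |κ| * S * K₄ + 8 * M * K₁ * S ≤ C ∧ M * a ^ 2 * S ≤ C ∧ M * a * b * S ≤ C := by
    have e1 : 0 ≤ K₃ + K₃ * S := by positivity
    have e2 : 0 ≤ a * S := by positivity
    have e3 : 0 ≤ b * S := by positivity
    have e4 : 0 ≤ 2 * |κ| * S * K₄ + 8 * M * K₁ * S := by positivity
    have e5 : 0 ≤ M * a ^ 2 * S := by positivity
    have e6 : 0 ≤ M * a * b * S := by positivity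
    refine ⟨?_, ?_, ?_, ?_, ?_, ?_, ?_⟩ <;> rw [hC] <;> linarith
  obtain ⟨c1, c2, c3, c4, c5, c6, c7⟩ := hterms
  set m := round x
  set γ := x - m
  have hγ : |γ| ≤ 1 / 2 := abs_sub_round x
  have hz : ∀ i : ℤ, (x - i) / ε = (γ - (i - m : ℤ)) / ε := fun i => by
    congr 1
    simp only [γ]
    push_cast
    ring
  set z : ℤ → ℝ := fun j => (γ - j) / ε with hzdef
  set p : ℤ → ℝ := fun j => if j = 0 then 0 else φ (z j) - step (z j) with hp
  set q : ℤ → ℝ := fun j => if j = 0 then 0 else ψ (z j) with hq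
  have p0 : p 0 = 0 := by simp [hp]
  have q0 : q 0 = 0 := by simp [hq]
  have p1 : ∀ j, j ≠ 0 → p j = φ (z j) - step (z j) := fun j hj => by simp [hp, hj]
  have q1 : ∀ j, j ≠ 0 → q j = ψ (z j) := fun j hj => by simp [hq, hj]
  have pe : ∀ j, |p j - κ * ε * (j:ℝ)⁻¹| ≤
      (2 * |κ| * (ε * |γ|) + 4 * K₁ * ε ^ 2) * ((j:ℝ) ^ 2)⁻¹ :=
    abs_rescaled_sub_le (f := fun z => φ z - step z) hK₁ h₁ hε hε1 hγ
  have qe : ∀ j, |q j - k * ε * (j:ℝ)⁻¹| ≤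
      (2 * |k| * (ε * |γ|) + 4 * K₂ * ε ^ 2) * ((j:ℝ) ^ 2)⁻¹ :=
    abs_rescaled_sub_le hK₂ h₂ hε hε1 hγ
  have pb : ∀ j, |p j| ≤ a * ε * |(j:ℝ)|⁻¹ :=
    abs_rescaled_le (f := fun z => φ z - step z) hK₁ h₁ hε hε1 hγ
  have qb : ∀ j, |q j| ≤ b * ε * |(j:ℝ)|⁻¹ := abs_rescaled_le hK₂ h₂ hε hε1 hγ
  have psq : ∀ j, M * p j ^ 2 ≤ M * a ^ 2 * ε ^ 2 * ((j:ℝ) ^ 2)⁻¹ := fun j => by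
    rw [← sq_abs (p j), ← sq_abs (j:ℝ)]
    calc M * |p j| ^ 2 ≤ M * (a * ε * |(j:ℝ)|⁻¹) ^ 2 := by have := pb j; gcongr
      _ = _ := by rw [mul_pow, inv_pow]; ring
  obtain ⟨P, hP, hPle⟩ := exists_hasSymSum_of_abs_sub_inv_le (u := fun i => p (i - m)) m (κ * ε)
    (fun i => by simpa using pe (i - m))
  obtain ⟨Q, hQ, hQle⟩ := exists_hasSymSum_of_abs_sub_inv_le (u := fun i => q (i - m)) m (k * ε)
    (fun i => by simpa using qe (i - m))
  obtain ⟨A, hA, hAle⟩ := exists_hasSymSum_of_abs_le (u := fun i => F (p (i - m)) - G 0 * p (i - m))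
    m (fun i => by simpa using (hF.abs_F_sub_le _).trans (psq (i - m)))
  obtain ⟨D, hD, hDle⟩ := exists_hasSymSum_of_abs_le
    (u := fun i => G (p (i - m)) - G 0 - H 0 * p (i - m))
    m (fun i => by simpa using (hF.abs_G_sub_le _).trans (psq (i - m)))
  obtain ⟨B, hB, hBle⟩ := exists_hasSymSum_of_abs_le
    (u := fun i => (G (p (i - m)) - G 0) * q (i - m)) (A := M * a * b * ε ^ 2) m (fun i => by
      have h1 : |G (p (i - m)) - G 0| ≤ M * |p (i - m)| := by
        simpa using hF.lipG (p (i - m)) 0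
      have h2 := pb (i - m)
      have h3 := qb (i - m)
      push_cast at h2 h3
      rw [abs_mul, ← sq_abs ((i:ℝ) - m)]
      calc |G (p (i - m)) - G 0| * |q (i - m)|
          ≤ M * (a * ε * |(i:ℝ) - m|⁻¹) * (b * ε * |(i:ℝ) - m|⁻¹) := by
            gcongr
            exact h1.trans (by gcongr)
        _ = _ := by rw [← inv_pow]; ring)
  obtain ⟨E, hE, hEle⟩ := exists_hasSymSum_of_abs_le
    (u := fun i => if i = m then 0 else deriv ψ ((x - i) / ε)) (A := K₃) m (fun i => by
      rcases eq_or_ne i m with rfl | hi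
      · simp
      have hi' : i - m ≠ 0 := sub_ne_zero.2 hi
      rw [if_neg hi, hz]
      refine (h₃ _).trans (mul_le_mul_of_nonneg_left ?_ hK₃.le)
      have h1 := one_le_abs_rescaled hε hε1 hγ hi'
      refine (lorentz_le_inv_sq (abs_pos.1 (by linarith))).trans
        ((inv_sq_rescaled_le hε hγ hi').trans ?_)
      push_cast
      refine mul_le_of_le_one_left (by positivity) ?_
      nlinarith)
  set Y := φ (γ / ε)
  set Z := ψ (γ / ε)
  have z0 : z 0 = γ / ε := by simp [hzdef]
  have int : ∀ j, j ≠ 0 → φ (z j) = p j + step (z j) := fun j hj => by rw [p1 j hj]; ring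
  have hPε : |P| ≤ a * S * ε := by
    refine hPle.trans ?_
    calc (2 * |κ| * (ε * |γ|) + 4 * K₁ * ε ^ 2) * S
        ≤ (2 * |κ| * (ε * 1) + 4 * K₁ * (ε * (1 / 2))) * S := by
          rw [sq ε]
          gcongr
          linarith
      _ = _ := by simp only [a]; ring
  have hQε : |Q| ≤ b * S * ε := by
    refine hQle.trans ?_
    calc (2 * |k| * (ε * |γ|) + 4 * K₂ * ε ^ 2) * S
        ≤ (2 * |k| * (ε * 1) + 4 * K₂ * (ε * (1 / 2))) * S := by
          rw [sq ε]
          gcongr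
          linarith
      _ = _ := by simp only [b]; ring
  refine ⟨Y, Z, P, Q, A, B, D, deriv ψ (γ / ε) + E, ?_, ?_, ?_, ?_, ?_, ?_, (h₅ _).trans c1,
    ?_, hPε.trans (by gcongr), hQε.trans (by gcongr), ?_, ?_, ?_, ?_⟩
  · have e : ∀ i : ℤ, φ ((x - i) / ε) =
        (if i = m then Y else 0) + p (i - m) + if i < m then 1 else 0 := by
      intro i
      rcases eq_or_ne i m with rfl | hi
      · simp [p0, Y, γ]
      · rw [hz, if_neg hi]
        change φ (z (i - m)) = _
        rw [int _ (sub_ne_zero.2 hi), step_rescaled hε hγ (sub_ne_zero.2 hi)]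
        simp only [sub_neg]
        push_cast
        ring
    have h := Tendsto.add ((HasSymSum.single m Y).add hP) (tendsto_sum_heaviside_sub m)
    rw [add_assoc, add_comm]
    refine h.congr fun n => ?_
    rw [← add_sub_assoc, ← Finset.sum_add_distrib]
    simp only [e]
  · have h := (HasSymSum.single m Z).add hQ
    convert h using 2 with i
    rcases eq_or_ne i m with rfl | hi
    · simp [q0, Z, γ]
    · rw [hz, if_neg hi, q1 _ (sub_ne_zero.2 hi), zero_add]
  · have h := ((HasSymSum.single m (F Y)).add (hP.const_mul (G 0))).add hA
    convert h using 2 with i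
    rcases eq_or_ne i m with rfl | hi
    · simp [p0, hF.zero, Y, γ]
    · rw [hz, if_neg hi]
      change F (φ (z (i - m))) = _
      rw [int _ (sub_ne_zero.2 hi), hF.F_add_int]
      ring
  · have h := ((HasSymSum.single m (G Y * Z)).add (hQ.const_mul (G 0))).add hB
    convert h using 2 with i
    rcases eq_or_ne i m with rfl | hi
    · simp [q0, Y, Z, γ]
    · rw [hz, if_neg hi]
      change G (φ (z (i - m))) * ψ (z (i - m)) = _
      rw [int _ (sub_ne_zero.2 hi), hF.G_add_int, q1 _ (sub_ne_zero.2 hi)]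
      ring
  · have h := ((HasSymSum.single m (G Y - G 0)).add (hP.const_mul (H 0))).add hD
    convert h using 2 with i
    rcases eq_or_ne i m with rfl | hi
    · simp [p0, Y, γ]
    · rw [hz, if_neg hi]
      change G (φ (z (i - m))) - G 0 = _
      rw [int _ (sub_ne_zero.2 hi), hF.G_add_int]
      ring
  · have h := (HasSymSum.single m (deriv ψ (γ / ε))).add hE
    convert h using 2 with i
    rcases eq_or_ne i m with rfl | hi
    · simp [γ]
    · simp [hi]
  · refine ((abs_add_le _ _).trans (add_le_add ((h₃ _).trans ?_) hEle)).trans c2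
    exact mul_le_of_le_one_right hK₃.le (lorentz_le_one _)
  · have h1 : |G Y - G 0| * |γ| ≤ K₄ * ε := by
      have := h₄ (γ / ε)
      rwa [abs_div, abs_of_pos hε, ← mul_div_assoc, div_le_iff₀ hε] at this
    have h2 : |G Y - G 0| ≤ 2 * M :=
      (abs_sub _ _).trans (by linarith [hF.boundG Y, hF.boundG 0])
    rw [abs_mul]
    calc |G Y - G 0| * |P|
        ≤ |G Y - G 0| * ((2 * |κ| * (ε * |γ|) + 4 * K₁ * ε ^ 2) * S) := by gcongr
      _ = 2 * |κ| * S * ε * (|G Y - G 0| * |γ|) + 4 * K₁ * S * ε ^ 2 * |G Y - G 0| := by ring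
      _ ≤ 2 * |κ| * S * ε * (K₄ * ε) + 4 * K₁ * S * ε ^ 2 * (2 * M) := by gcongr
      _ = (2 * |κ| * S * K₄ + 8 * M * K₁ * S) * ε ^ 2 := by ring
      _ ≤ C * ε ^ 2 := by gcongr
  · refine hAle.trans ?_
    calc M * a ^ 2 * ε ^ 2 * S = M * a ^ 2 * S * ε ^ 2 := by ring
      _ ≤ C * ε ^ 2 := by gcongr
  · refine hBle.trans ?_
    calc M * a * b * ε ^ 2 * S = M * a * b * S * ε ^ 2 := by ring
      _ ≤ C * ε ^ 2 := by gcongr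
  · refine hDle.trans ?_
    calc M * a ^ 2 * ε ^ 2 * S = M * a ^ 2 * S * ε ^ 2 := by ring
      _ ≤ C * ε ^ 2 := by gcongr

/-- The operator evaluated at the ansatz, with the equations of `φ` and `ψ` inserted. -/
lemma NLop_sApprox {W φ ψ : ℝ → ℝ} {L l δ p0 : ℝ} (hl : l = L / deriv (deriv W) 0)
    (hφ : IsLayer (deriv W) φ)
    (hψ : IsCorrector (deriv (deriv W)) φ l (L / ∫ y : ℝ, (deriv φ y) ^ 2) ψ)
    (hε : 0 < δ * |p0|) (n : ℕ) (x : ℝ) :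
    NLop W L δ p0 (lamBar φ δ p0 L) (sApprox W φ ψ L δ p0 n) x =
      δ ^ 2 * (L / ∫ y : ℝ, (deriv φ y) ^ 2) *
        ∑ i ∈ Finset.Icc (-(n:ℤ)) n, deriv ψ ((x - i) / (δ * |p0|)) +
      deriv W (δ * l + (∑ i ∈ Finset.Icc (-(n:ℤ)) n, φ ((x - i) / (δ * |p0|)) - n) +
        δ * ∑ i ∈ Finset.Icc (-(n:ℤ)) n, ψ ((x - i) / (δ * |p0|))) -
      ∑ i ∈ Finset.Icc (-(n:ℤ)) n, deriv W (φ ((x - i) / (δ * |p0|))) -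
      δ * (∑ i ∈ Finset.Icc (-(n:ℤ)) n,
        deriv (deriv W) (φ ((x - i) / (δ * |p0|))) * ψ ((x - i) / (δ * |p0|))) -
      δ * l * (∑ i ∈ Finset.Icc (-(n:ℤ)) n,
        (deriv (deriv W) (φ ((x - i) / (δ * |p0|))) - deriv (deriv W) 0)) - δ * L := by
  set ε := δ * |p0| with hεdef
  set I := ∫ y : ℝ, (deriv φ y) ^ 2 with hI
  set s := Finset.Icc (-(n:ℤ)) n with hs
  have hz : ∀ (i : ℤ) (y : ℝ), (y - i) / ε = ε⁻¹ * y + -(ε⁻¹ * i) := fun i y => by ring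
  have bφ : ∀ i : ℤ, BddC2 (fun y => φ ((y - i) / ε)) := fun i => by
    simpa only [hz] using hφ.bddC2.comp_affine ε⁻¹ (-(ε⁻¹ * i))
  have bψ : ∀ i : ℤ, BddC2 (fun y => ψ ((y - i) / ε)) := fun i => by
    simpa only [hz] using hψ.bddC2.comp_affine ε⁻¹ (-(ε⁻¹ * i))
  have lφ : ∀ i : ℤ, symLap (fun y => φ ((y - i) / ε)) x = ε⁻¹ * deriv W (φ ((x - i) / ε)) :=
    fun i => by
      simp only [hz]
      rw [symLap_comp_affine φ (inv_pos.2 hε), hφ.eq]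
  have lψ : ∀ i : ℤ, symLap (fun y => ψ ((y - i) / ε)) x = ε⁻¹ *
      (deriv (deriv W) (φ ((x - i) / ε)) * ψ ((x - i) / ε) +
      l * (deriv (deriv W) (φ ((x - i) / ε)) - deriv (deriv W) 0) +
      L / I * deriv φ ((x - i) / ε)) :=
    fun i => by
      simp only [hz]
      rw [symLap_comp_affine ψ (inv_pos.2 hε), hψ.eq]
  have hda : ∀ (i : ℤ) {f : ℝ → ℝ}, BddC2 f →
      HasDerivAt (fun y => f ((y - i) / ε)) (deriv f ((x - i) / ε) * (1 / ε)) x :=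
    fun i f hf => (hf.hasDerivAt ((x - i) / ε)).comp x
      (((hasDerivAt_id x).sub_const (i:ℝ)).div_const ε)
  have hS : sApprox W φ ψ L δ p0 n = fun y => (δ * l - n + ∑ i ∈ s, φ ((y - i) / ε)) +
      δ * ∑ i ∈ s, ψ ((y - i) / ε) := by
    ext y
    rw [sApprox, hl]
    ring
  have bΦ := BddC2.sum s bφ
  have bΨ := (BddC2.sum s bψ).const_mul δ
  have bC := (BddC2.const (δ * l - n)).add bΦ
  have hlap : halfLap (sApprox W φ ψ L δ p0 n) x =
      ∑ i ∈ s, ε⁻¹ * deriv W (φ ((x - i) / ε)) + δ * ∑ i ∈ s, ε⁻¹ *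
      (deriv (deriv W) (φ ((x - i) / ε)) * ψ ((x - i) / ε) +
      l * (deriv (deriv W) (φ ((x - i) / ε)) - deriv (deriv W) 0) +
      L / I * deriv φ ((x - i) / ε)) := by
    rw [hS, (bC.add bΨ).halfLap_eq, bC.symLap_add bΨ, (BddC2.const _).symLap_add bΦ, symLap_const,
      symLap_const_mul, BddC2.symLap_sum s bφ, BddC2.symLap_sum s bψ, zero_add]
    simp only [lφ, lψ]
  have hder : deriv (sApprox W φ ψ L δ p0 n) x =
      ∑ i ∈ s, deriv φ ((x - i) / ε) * (1 / ε) + δ * ∑ i ∈ s, deriv ψ ((x - i) / ε) * (1 / ε) := by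
    rw [hS]
    refine HasDerivAt.deriv ?_
    exact ((HasDerivAt.fun_sum fun i _ => hda i hφ.bddC2).const_add _).add
      ((HasDerivAt.fun_sum fun i _ => hda i hψ.bddC2).const_mul δ)
  have hlam : lamBar φ δ p0 L = ε * (δ * (L / I)) := by
    rw [lamBar, ← hI, hεdef]
    ring
  rw [NLop, hlap, hder, hlam, ← hεdef, hS]
  simp only [← Finset.sum_mul, ← Finset.mul_sum, Finset.sum_add_distrib]
  rw [show δ * l - n + ∑ i ∈ s, φ ((x - i) / ε) = δ * l + (∑ i ∈ s, φ ((x - i) / ε) - n) by ring]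
  have hε0 := hε.ne'
  generalize L / I = c
  field_simp
  ring

/-- The limit of the operator along the ansatz, in terms of the lattice sums. -/
lemma exists_limit_abs_le {F G H φ ψ : ℝ → ℝ} {M L l c m : ℝ} (hF : IsForce F G H M)
    (hα : 0 < G 0) (hφ : IsLayer F φ) (hψ : IsCorrector G φ l c ψ) (hl : l = L / G 0)
    (hm : 0 < m) :
    ∃ C > 0, ∀ δ, 0 < δ → δ * m ≤ 1 / 2 → ∀ x : ℝ, ∃ lx : ℝ,
      Tendsto (fun n : ℕ =>
        δ ^ 2 * c * ∑ i ∈ Finset.Icc (-(n:ℤ)) n, deriv ψ ((x - i) / (δ * m)) +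
        F (δ * l + (∑ i ∈ Finset.Icc (-(n:ℤ)) n, φ ((x - i) / (δ * m)) - n) +
          δ * ∑ i ∈ Finset.Icc (-(n:ℤ)) n, ψ ((x - i) / (δ * m))) -
        ∑ i ∈ Finset.Icc (-(n:ℤ)) n, F (φ ((x - i) / (δ * m))) -
        δ * (∑ i ∈ Finset.Icc (-(n:ℤ)) n, G (φ ((x - i) / (δ * m))) * ψ ((x - i) / (δ * m))) -
        δ * l * (∑ i ∈ Finset.Icc (-(n:ℤ)) n, (G (φ ((x - i) / (δ * m))) - G 0)) - δ * L)
        atTop (𝓝 lx) ∧ |lx| ≤ C * δ ^ 2 := by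
  obtain ⟨C, hC, hlim⟩ := exists_lattice_limits hF hα hφ hψ
  have hM := hF.pos
  set T := |l| + C * m + 2 * C
  refine ⟨|c| * C + M * T ^ 2 + 2 * C * m ^ 2 + 2 * M * C * m + C * m + |l| * |H 0| * C * m +
    |l| * C * m, by positivity, fun δ hδ hε1 x => ?_⟩
  set ε := δ * m
  have hε0 : 0 < ε := mul_pos hδ hm
  obtain ⟨Y, Z, P, Q, A, B, D, E, tφ, tψ, tF, tG, tH, tE, bZ, bE, bP, bQ, bGP, bA, bB, bD⟩ :=
    hlim ε hε0 hε1 x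
  have hFc : Continuous F := continuous_iff_continuousAt.2 fun y => (hF.derivF y).continuousAt
  set τ := δ * l + P + δ * (Z + Q) with hτ
  set R := F (Y + τ) - F Y - G Y * τ with hR
  rw [HasSymSum] at tψ tF tG tH tE
  have hT := (((((tE.const_mul (δ ^ 2 * c)).add ((hFc.tendsto _).comp
    ((tφ.const_add (δ * l)).add (Tendsto.const_mul δ tψ)))).sub tF).sub
    (Tendsto.const_mul δ tG)).sub (Tendsto.const_mul (δ * l) tH)).sub_const (δ * L)
  refine ⟨_, hT, ?_⟩
  have hval : δ ^ 2 * c * E + F (δ * l + (round x + Y + P) + δ * (Z + Q)) - (F Y + G 0 * P + A) -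
      δ * (G Y * Z + G 0 * Q + B) - δ * l * (G Y - G 0 + H 0 * P + D) - δ * L =
      δ ^ 2 * c * E + R + (G Y - G 0) * P - A + δ * (G Y - G 0) * Q - δ * B -
        δ * l * H 0 * P - δ * l * D := by
    have e : δ * l + (round x + Y + P) + δ * (Z + Q) = Y + τ + round x := by rw [hτ]; ring
    have hL : L = l * G 0 := by rw [hl, div_mul_cancel₀ _ hα.ne']
    rw [e, hF.F_add_int, hL, hR, hτ]
    ring
  have hτle : |τ| ≤ T * δ := by
    have h1 : |τ| ≤ δ * |l| + |P| + δ * (|Z| + |Q|) := by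
      rw [hτ]
      refine (abs_add_three _ _ _).trans ?_
      rw [abs_mul, abs_mul, abs_of_pos hδ]
      gcongr
      exact abs_add_le _ _
    have h3 : |Q| ≤ C := bQ.trans (mul_le_of_le_one_right hC.le (by linarith))
    calc |τ| ≤ δ * |l| + C * ε + δ * (C + C) := h1.trans (by gcongr)
      _ = _ := by simp only [T, ε]; ring
  have hRle : |R| ≤ M * T ^ 2 * δ ^ 2 := by
    calc |R| ≤ M * |τ| ^ 2 := by rw [sq_abs]; exact hF.taylorF Y τ
      _ ≤ M * (T * δ) ^ 2 := by gcongr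
      _ = _ := by ring
  have hG2 : |G Y - G 0| ≤ 2 * M :=
    (abs_sub _ _).trans (by linarith [hF.boundG Y, hF.boundG 0])
  have hεsq : ε ^ 2 ≤ ε := by nlinarith
  have k1 : |δ ^ 2 * c * E| ≤ |c| * C * δ ^ 2 := by
    rw [abs_mul, abs_mul, abs_of_pos (pow_pos hδ 2)]
    calc δ ^ 2 * |c| * |E| ≤ δ ^ 2 * |c| * C := by gcongr
      _ = _ := by ring
  have k2 : |δ * (G Y - G 0) * Q| ≤ 2 * M * C * m * δ ^ 2 := by
    rw [abs_mul, abs_mul, abs_of_pos hδ]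
    calc δ * |G Y - G 0| * |Q| ≤ δ * (2 * M) * (C * ε) := by gcongr
      _ = _ := by simp only [ε]; ring
  have k3 : |δ * B| ≤ C * m * δ ^ 2 := by
    rw [abs_mul, abs_of_pos hδ]
    calc δ * |B| ≤ δ * (C * ε) := by gcongr; exact bB.trans (by gcongr)
      _ = _ := by simp only [ε]; ring
  have k4 : |δ * l * H 0 * P| ≤ |l| * |H 0| * C * m * δ ^ 2 := by
    rw [abs_mul, abs_mul, abs_mul, abs_of_pos hδ]
    calc δ * |l| * |H 0| * |P| ≤ δ * |l| * |H 0| * (C * ε) := by gcongr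
      _ = _ := by simp only [ε]; ring
  have k5 : |δ * l * D| ≤ |l| * C * m * δ ^ 2 := by
    rw [abs_mul, abs_mul, abs_of_pos hδ]
    calc δ * |l| * |D| ≤ δ * |l| * (C * ε) := by gcongr; exact bD.trans (by gcongr)
      _ = _ := by simp only [ε]; ring
  have k6 : C * ε ^ 2 = C * m ^ 2 * δ ^ 2 := by simp only [ε]; ring
  rw [k6] at bGP bA
  rw [hval]
  have t1 := abs_sub (δ ^ 2 * c * E + R + (G Y - G 0) * P - A + δ * (G Y - G 0) * Q - δ * B -
    δ * l * H 0 * P) (δ * l * D)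
  have t2 := abs_sub (δ ^ 2 * c * E + R + (G Y - G 0) * P - A + δ * (G Y - G 0) * Q - δ * B)
    (δ * l * H 0 * P)
  have t3 := abs_sub (δ ^ 2 * c * E + R + (G Y - G 0) * P - A + δ * (G Y - G 0) * Q) (δ * B)
  have t4 := abs_add_le (δ ^ 2 * c * E + R + (G Y - G 0) * P - A) (δ * (G Y - G 0) * Q)
  have t5 := abs_sub (δ ^ 2 * c * E + R + (G Y - G 0) * P) A
  have t6 := abs_add_le (δ ^ 2 * c * E + R) ((G Y - G 0) * P)
  have t7 := abs_add_le (δ ^ 2 * c * E) R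
  linarith

/-- **Lemma 6.9.**  Assume (W) with `N = 1`, `g ≡ 1/π`, and let `p0 ≠ 0`, `L ∈ ℝ`.  There is
`C > 0` independent of `x` such that for every `δ > 0` with `1/(δ|p0|) ≥ 2` and every
`x ∈ ℝ`, the limit `lim_{n→∞} NL_L^{λ̄_δ^L}[s_{δ,n}^L](x)` exists and lies in
`[−Cδ², Cδ²]`. -/
theorem NL_of_sApprox_bound (W : ℝ → ℝ) (hW : AssumptionW W) (φ : ℝ → ℝ) (hφ : IsPhi W φ)
    (L : ℝ) (ψ : ℝ → ℝ) (hψ : IsPsi W φ L ψ) (p0 : ℝ) (hp0 : p0 ≠ 0) :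
    ∃ C > (0:ℝ), ∀ δ : ℝ, 0 < δ → 2 ≤ 1 / (δ * |p0|) → ∀ x : ℝ,
      ∃ lx : ℝ,
        Tendsto (fun n : ℕ =>
          NLop W L δ p0 (lamBar φ δ p0 L) (sApprox W φ ψ L δ p0 n) x) atTop (𝓝 lx) ∧
        -C * δ ^ 2 ≤ lx ∧ lx ≤ C * δ ^ 2 := by
  obtain ⟨M, hF⟩ := hW.exists_isForce
  have hα : 0 < deriv (deriv W) 0 := hW.2.2.2.2
  have hm : 0 < |p0| := abs_pos.2 hp0
  obtain ⟨C, hC, h⟩ := exists_limit_abs_le hF hα hφ.isLayer hψ.isCorrector rfl hm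
  refine ⟨C, hC, fun δ hδ h2 x => ?_⟩
  have hε : 0 < δ * |p0| := mul_pos hδ hm
  rw [le_div_iff₀ hε] at h2
  obtain ⟨lx, hlx, hle⟩ := h δ hδ (by linarith) x
  refine ⟨lx, hlx.congr fun n => (NLop_sApprox rfl hφ.isLayer hψ.isCorrector hε n x).symm, ?_⟩
  rw [neg_mul, ← abs_le]
  exact hle
end
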